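/- arXiv:1707.08786 — 6 statements merged into one kernel-verified Lean document; each statement's English description precedes it below -/
import Mathlib

section
/- Let F : ℝ^n → ℝ^n be a piecewise affine function that is nonsingular at infinity with respect to a corresponding polyhedral subdivision 𝒫(F). If there exists a regular value y of F with Σ_{x ∈ F⁻¹(y)} sign(det D_xF) ≠ 0, then F is surjective. -/
open Set Filter Bornology

noncomputable section

/-- A (closed convex) polyhedron in `ℝⁿ`: a finite intersection of closed halfspaces. -/
def IsPolyhedron {n : ℕ} (P : Set (Fin n → ℝ)) : Prop :=
  ∃ (m : ℕ) (a : Fin m → (Fin n → ℝ)) (c : Fin m → ℝ),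
    P = {x | ∀ i, (∑ j, a i j * x j) ≤ c i}

/-- `G` is a proper face of the polyhedron `P`: `G ≠ P` and `G` is either empty or the
intersection of `P` with a supporting hyperplane. -/
def IsProperFaceOf {n : ℕ} (G P : Set (Fin n → ℝ)) : Prop :=
  G ≠ P ∧ (G = ∅ ∨ ∃ (a : Fin n → ℝ) (c : ℝ),
    (∀ x ∈ P, (∑ j, a j * x j) ≤ c) ∧ G = {x ∈ P | (∑ j, a j * x j) = c})

/-- The affine map `x ↦ A x + b` encoded by the pair `p = (A, b)`. -/
def affMap {n : ℕ} (p : Matrix (Fin n) (Fin n) ℝ × (Fin n → ℝ)) :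
    (Fin n → ℝ) → (Fin n → ℝ) :=
  fun x => p.1.mulVec x + p.2

/-- The selection function `p` is active (for `F`) on the set `U`. -/
def ActiveOn {n : ℕ} (F : (Fin n → ℝ) → (Fin n → ℝ))
    (p : Matrix (Fin n) (Fin n) ℝ × (Fin n → ℝ)) (U : Set (Fin n → ℝ)) : Prop :=
  ∀ x ∈ U, F x = affMap p x

/-- `F` is piecewise affine with (finite) set of selection functions `S`. -/
def IsPWA {n : ℕ} (F : (Fin n → ℝ) → (Fin n → ℝ))
    (S : Finset (Matrix (Fin n) (Fin n) ℝ × (Fin n → ℝ))) : Prop :=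
  Continuous F ∧ ∀ x, ∃ p ∈ S, F x = affMap p x

/-- `𝒞` is a polyhedral subdivision of `ℝⁿ` corresponding to the piecewise affine `F`
with selection functions `S`. -/
def IsSubdivision {n : ℕ} (F : (Fin n → ℝ) → (Fin n → ℝ))
    (S : Finset (Matrix (Fin n) (Fin n) ℝ × (Fin n → ℝ)))
    (𝒞 : Set (Set (Fin n → ℝ))) : Prop :=
  𝒞.Finite ∧
  (∀ P ∈ 𝒞, IsPolyhedron P ∧ (interior P).Nonempty) ∧
  ⋃₀ 𝒞 = univ ∧
  (∀ P ∈ 𝒞, ∃ p ∈ S, ActiveOn F p P) ∧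
  (∀ P ∈ 𝒞, ∀ Q ∈ 𝒞, P ≠ Q →
    P ∩ Q = ∅ ∨ (IsProperFaceOf (P ∩ Q) P ∧ IsProperFaceOf (P ∩ Q) Q))

/-- `F` is nonsingular at infinity w.r.t. the subdivision `𝒞`: every selection function
active on an unbounded polyhedron of `𝒞` has invertible linear part. -/
def NonsingularAtInfinity {n : ℕ} (F : (Fin n → ℝ) → (Fin n → ℝ))
    (S : Finset (Matrix (Fin n) (Fin n) ℝ × (Fin n → ℝ)))
    (𝒞 : Set (Set (Fin n → ℝ))) : Prop :=
  ∀ p ∈ S, ∀ P ∈ 𝒞, ¬ IsBounded P → ActiveOn F p P → p.1.det ≠ 0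

/-- `y` is a regular value of `F`. -/
def IsRegularValue {n : ℕ} (F : (Fin n → ℝ) → (Fin n → ℝ)) (y : Fin n → ℝ) : Prop :=
  ∀ x, F x = y → DifferentiableAt ℝ F x ∧ (fderiv ℝ F x).det ≠ 0

/-- The signed count of preimages of `y` under `F`. -/
def degSum {n : ℕ} (F : (Fin n → ℝ) → (Fin n → ℝ)) (y : Fin n → ℝ) : ℝ :=
  ∑ᶠ x ∈ F ⁻¹' {y}, Real.sign ((fderiv ℝ F x).det)

open scoped Topology

variable {E : Type*} [NormedAddCommGroup E] [NormedSpace ℝ E]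

/-- The number of solutions `x ∈ s` of `G x = z`, counted with the sign of the Jacobian. -/
def signedCount (G : E → E) (s : Set E) (z : E) : ℝ :=
  ∑ᶠ x ∈ s ∩ G ⁻¹' {z}, Real.sign (fderiv ℝ G x).det

lemma degSum_eq_signedCount {n : ℕ} (F : (Fin n → ℝ) → (Fin n → ℝ)) (y : Fin n → ℝ) :
    degSum F y = signedCount F univ y := by
  simp [degSum, signedCount]

lemma signedCount_eq_zero {G : E → E} {s : Set E} {z : E} (h : ∀ x ∈ s, G x ≠ z) :
    signedCount G s z = 0 := by
  have : s ∩ G ⁻¹' {z} = ∅ := by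
    ext x
    simpa using h x
  simp [signedCount, this]

lemma signedCount_congr {G : E → E} {s t : Set E} {z : E} (h : ∀ x, G x = z → (x ∈ s ↔ x ∈ t)) :
    signedCount G s z = signedCount G t z := by
  have : s ∩ G ⁻¹' {z} = t ∩ G ⁻¹' {z} := by
    ext x
    simpa using h x
  simp [signedCount, this]

lemma signedCount_union {G : E → E} {s t : Set E} {z : E} (hst : Disjoint s t)
    (hfin : (G ⁻¹' {z}).Finite) :
    signedCount G (s ∪ t) z = signedCount G s z + signedCount G t z := by
  rw [signedCount, union_inter_distrib_right]
  exact finsum_mem_union (hst.mono inter_subset_left inter_subset_left)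
    (hfin.subset inter_subset_right) (hfin.subset inter_subset_right)

lemma signedCount_biUnion {G : E → E} {z : E} (X : Finset E) (s : E → Set E)
    (hs : (X : Set E).PairwiseDisjoint s) (hfin : (G ⁻¹' {z}).Finite)
    (hcover : ∀ x, G x = z → ∃ y ∈ X, x ∈ s y) :
    signedCount G univ z = ∑ y ∈ X, signedCount G (s y) z := by
  have h₁ : univ ∩ G ⁻¹' {z} = ⋃ y ∈ (X : Set E), s y ∩ G ⁻¹' {z} := by
    ext x
    simp only [univ_inter, mem_preimage, mem_singleton_iff, mem_iUnion, mem_inter_iff]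
    exact ⟨fun h ↦ let ⟨y, hy, hx⟩ := hcover x h; ⟨y, hy, hx, h⟩, fun ⟨_, _, _, h⟩ ↦ h⟩
  rw [signedCount, h₁, finsum_mem_biUnion (hs.mono fun y ↦ inter_subset_left) X.finite_toSet
    fun y _ ↦ hfin.subset inter_subset_right]
  exact finsum_mem_coe_finset _ _

/-- On an open set where `G` is affine with invertible linear part there is at most one
solution. -/
lemma signedCount_affine {G : E → E} {U : Set E} (hU : IsOpen U) {A : E ≃L[ℝ] E} {x₀ w : E}
    (hG : ∀ x ∈ U, G x = w + A (x - x₀)) (z : E) [Decidable (x₀ + A.symm (z - w) ∈ U)] :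
    signedCount G U z =
      if x₀ + A.symm (z - w) ∈ U then Real.sign (A : E →L[ℝ] E).det else 0 := by
  have key : ∀ x ∈ U, (G x = z ↔ x = x₀ + A.symm (z - w)) := by
    intro x hx
    rw [hG x hx, ← sub_eq_iff_eq_add', A.symm.map_sub, ← map_sub, A.eq_symm_apply, eq_sub_iff_add_eq,
      add_comm]
  split_ifs with h
  · have hset : U ∩ G ⁻¹' {z} = {x₀ + A.symm (z - w)} := by
      ext x
      simp only [mem_inter_iff, mem_preimage, mem_singleton_iff]
      exact ⟨fun hx ↦ (key x hx.1).1 hx.2, fun hx ↦ ⟨hx ▸ h, (key x (hx ▸ h)).2 hx⟩⟩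
    have hd : HasFDerivAt G (A : E →L[ℝ] E) (x₀ + A.symm (z - w)) := by
      have h₁ : HasFDerivAt (fun x ↦ w + A (x - x₀)) (A : E →L[ℝ] E) (x₀ + A.symm (z - w)) :=
        ((A : E →L[ℝ] E).hasFDerivAt.comp _ ((hasFDerivAt_id _).sub_const x₀)).const_add w
      exact h₁.congr_of_eventuallyEq (eventually_of_mem (hU.mem_nhds h) hG)
    rw [signedCount, hset, finsum_mem_singleton, hd.fderiv]
  · refine signedCount_eq_zero fun x hx hxz ↦ h ?_
    rw [← (key x hx).1 hxz]
    exact hx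

lemma ContinuousLinearEquiv.det_mul_apply_symm [FiniteDimensional ℝ E] {A B : E ≃L[ℝ] E}
    {a : E →L[ℝ] ℝ} (h : ∀ x, a x = 0 → A x = B x) (v : E) :
    (A : E →L[ℝ] E).det * a (A.symm v) = (B : E →L[ℝ] E).det * a (B.symm v) := by
  by_cases ha : a = 0
  · simp [ha]
  obtain ⟨e, he⟩ : ∃ e, a e = 1 := by
    obtain ⟨e, he⟩ : ∃ e, a e ≠ 0 := by
      by_contra! h
      exact ha (ContinuousLinearMap.ext h)
    exact ⟨(a e)⁻¹ • e, by simp [he]⟩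
  set u := A.symm (B e - A e) with hu
  have hB : ∀ x, B x = A (x + a x • u) := by
    intro x
    have := h (x - a x • e) (by simp [he])
    simp only [map_sub, map_smul] at this
    simp only [map_add, map_smul, hu, A.apply_symm_apply, smul_sub]
    rw [← add_sub_assoc, eq_sub_iff_add_eq, ← sub_eq_sub_iff_add_eq_add.1 this]
  have hdet : (B : E →L[ℝ] E).det = (A : E →L[ℝ] E).det * (1 + a u) := by
    have h₁ : ((B : E →L[ℝ] E) : E →ₗ[ℝ] E) =
        ((A : E →L[ℝ] E) : E →ₗ[ℝ] E) ∘ₗ LinearMap.transvection (a : E →ₗ[ℝ] ℝ) u := by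
      ext x
      simpa [LinearMap.transvection.apply] using hB x
    rw [ContinuousLinearMap.det, h₁, LinearMap.det_comp, LinearMap.transvection.det]
    rfl
  have hv : A.symm v = B.symm v + a (B.symm v) • u := by
    rw [A.symm_apply_eq, ← hB, B.apply_symm_apply]
  rw [hdet, hv]
  simp
  ring

/-- Near `x₀`, the map `G` is affine and invertible on each of two closed half-balls whose
interface is transverse to the preimages of the direction `v`. -/
def TwoSidedAffineAt (G : E → E) (v x₀ : E) : Prop :=
  ∃ (a : E →L[ℝ] ℝ) (A B : E ≃L[ℝ] E), a (A.symm v) ≠ 0 ∧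
    ∀ᶠ x in 𝓝 x₀, (0 ≤ a (x - x₀) → G x = G x₀ + A (x - x₀)) ∧
      (a (x - x₀) ≤ 0 → G x = G x₀ + B (x - x₀))

lemma signedCount_half_ball {G : E → E} {x₀ v : E} {r : ℝ} (hr : 0 < r) {a : E →L[ℝ] ℝ}
    {A : E ≃L[ℝ] E} (hG : ∀ x ∈ Metric.ball x₀ r, 0 < a (x - x₀) → G x = G x₀ + A (x - x₀)) :
    ∀ᶠ τ : ℝ in 𝓝 0, signedCount G (Metric.ball x₀ r ∩ {x | 0 < a (x - x₀)}) (G x₀ + τ • v) =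
      if 0 < τ * a (A.symm v) then Real.sign (A : E →L[ℝ] E).det else 0 := by
  classical
  have hU : IsOpen (Metric.ball x₀ r ∩ {x | 0 < a (x - x₀)}) :=
    Metric.isOpen_ball.inter (isOpen_lt continuous_const (by fun_prop))
  have hlim : ∀ᶠ τ : ℝ in 𝓝 0, x₀ + τ • A.symm v ∈ Metric.ball x₀ r := by
    have hc : Continuous fun τ : ℝ ↦ x₀ + τ • A.symm v := by fun_prop
    exact hc.continuousAt.eventually_mem (by simpa using Metric.ball_mem_nhds x₀ hr)
  filter_upwards [hlim] with τ hτ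
  rw [signedCount_affine hU (fun x hx ↦ hG x hx.1 hx.2)]
  refine if_congr ?_ rfl rfl
  simp only [add_sub_cancel_left, map_smul, mem_inter_iff, hτ, mem_ofPred_eq, true_and, smul_eq_mul]

lemma sign_crossing {p q α β τ : ℝ} (hp : p ≠ 0) (hq : q ≠ 0) (hα : α ≠ 0) (hβ : β ≠ 0)
    (hτ : τ ≠ 0) (h : p * α = q * β) :
    ((if 0 < τ * α then Real.sign p else 0) + if 0 < τ * -β then Real.sign q else 0) =
      if 0 < α * β then Real.sign p else 0 := by
  rcases hτ.lt_or_gt with hτ | hτ <;> rcases hα.lt_or_gt with hα | hα <;>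
  rcases hβ.lt_or_gt with hβ | hβ <;> rcases hp.lt_or_gt with hp | hp <;>
  rcases hq.lt_or_gt with hq | hq <;>
  first
  | (exfalso; nlinarith)
  | simp [Real.sign_of_pos, Real.sign_of_neg, hp, hq, mul_pos_iff, mul_neg_iff, hα, hβ, hτ,
      hα.not_gt, hβ.not_gt, hτ.not_gt]

lemma TwoSidedAffineAt.eventually_signedCount [FiniteDimensional ℝ E] {G : E → E} {v x₀ : E}
    (h : TwoSidedAffineAt G v x₀) (hfin : ∀ z, (G ⁻¹' {z}).Finite) :
    ∀ᶠ r in 𝓝[>] (0 : ℝ), ∃ e, ∀ᶠ τ in 𝓝[≠] (0 : ℝ),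
      signedCount G (Metric.ball x₀ r) (G x₀ + τ • v) = e := by
  obtain ⟨a, A, B, hα, hG⟩ := h
  obtain ⟨R, hR, hGR⟩ := Metric.eventually_nhds_iff_ball.1 hG
  filter_upwards [Ioo_mem_nhdsGT hR] with r hr
  have hball : ∀ x ∈ Metric.ball x₀ r, (0 ≤ a (x - x₀) → G x = G x₀ + A (x - x₀)) ∧
      (a (x - x₀) ≤ 0 → G x = G x₀ + B (x - x₀)) :=
    fun x hx ↦ hGR x (Metric.ball_subset_ball hr.2.le hx)
  have hAB : ∀ x, a x = 0 → A x = B x := by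
    intro x hx
    have hc : ∀ᶠ s : ℝ in 𝓝[≠] 0, x₀ + s • x ∈ Metric.ball x₀ r := by
      have hc : Continuous fun s : ℝ ↦ x₀ + s • x := by fun_prop
      exact (hc.continuousAt.eventually_mem
        (by simpa using Metric.ball_mem_nhds x₀ hr.1)).filter_mono nhdsWithin_le_nhds
    obtain ⟨s, hs, hs0⟩ := (hc.and self_mem_nhdsWithin).exists
    have h₁ := hball _ hs
    simp only [add_sub_cancel_left, map_smul, hx, smul_zero, le_refl, true_imp_iff] at h₁
    exact smul_right_injective E hs0 (add_left_cancel (h₁.1.symm.trans h₁.2))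
  have hdet := ContinuousLinearEquiv.det_mul_apply_symm hAB v
  have hA : (A : E →L[ℝ] E).det ≠ 0 := (LinearEquiv.isUnit_det' A.toLinearEquiv).ne_zero
  have hB : (B : E →L[ℝ] E).det ≠ 0 := (LinearEquiv.isUnit_det' B.toLinearEquiv).ne_zero
  have hpos := signedCount_half_ball (v := v) hr.1 (a := a) (A := A)
    fun x hx h ↦ (hball x hx).1 h.le
  have hneg := signedCount_half_ball (v := v) hr.1 (a := -a) (A := B)
    fun x hx h ↦ (hball x hx).2 (by simpa using h.le)
  set α := a (A.symm v)
  set β := a (B.symm v)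
  refine ⟨if 0 < α * β then Real.sign (A : E →L[ℝ] E).det else 0, ?_⟩
  filter_upwards [hpos.filter_mono nhdsWithin_le_nhds, hneg.filter_mono nhdsWithin_le_nhds,
    self_mem_nhdsWithin] with τ hτp hτn hτ
  have hτ : τ ≠ 0 := hτ
  have hsplit : signedCount G (Metric.ball x₀ r) (G x₀ + τ • v) =
      signedCount G (Metric.ball x₀ r ∩ {x | 0 < a (x - x₀)} ∪
        Metric.ball x₀ r ∩ {x | 0 < (-a) (x - x₀)}) (G x₀ + τ • v) := by
    refine signedCount_congr fun x hx ↦ ?_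
    rw [← inter_union_distrib_left]
    refine ⟨fun hxb ↦ ⟨hxb, ?_⟩, fun hxb ↦ hxb.1⟩
    rcases lt_trichotomy (a (x - x₀)) 0 with h | h | h
    · exact Or.inr (by simpa using h)
    · have h₁ := (hball x hxb).1 h.ge
      rw [hx, add_right_inj, ← A.symm_apply_eq] at h₁
      rw [← h₁, map_smul, map_smul, smul_eq_mul] at h
      exact absurd h (mul_ne_zero hτ hα)
    · exact Or.inl h
  rw [hsplit, signedCount_union _ (hfin _), hτp, hτn]
  · have hβ : β ≠ 0 := by
      intro h
      rw [h, mul_zero] at hdet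
      exact mul_ne_zero hA hα hdet
    have hneg' : (-a) (B.symm v) = -β := rfl
    rw [hneg']
    exact sign_crossing hA hB hα hβ hτ hdet
  · refine Disjoint.mono inter_subset_right inter_subset_right ?_
    rw [Set.disjoint_left]
    intro x hx hx'
    simp only [mem_ofPred_eq, neg_apply] at hx hx'
    linarith

lemma exists_mul_one_add_norm_le [FiniteDimensional ℝ E] {G : E → E} (hG : Continuous G) {K : ℝ}
    (hK : ∀ x, ‖x‖ ≤ K * (‖G x‖ + 1)) {z : E} {N : Set E} (hN : IsOpen N)
    (hzN : ∀ x, G x = z → x ∈ N) :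
    ∃ η > 0, ∀ x ∉ N, η * (1 + ‖x‖) ≤ ‖G x - z‖ := by
  have : ProperSpace E := FiniteDimensional.proper ℝ E
  obtain ⟨K, hKpos, hK⟩ : ∃ K > 0, ∀ x, ‖x‖ ≤ K * (‖G x‖ + 1) :=
    ⟨max K 1, by positivity, fun x ↦ (hK x).trans (by gcongr; exact le_max_left _ _)⟩
  set R := 2 * K * (2 + ‖z‖) with hR
  have hRpos : 0 < R := by positivity
  obtain ⟨m, hm, hmle⟩ := ((isCompact_closedBall (0 : E) R).diff hN).exists_forall_le'
    (f := fun x ↦ ‖G x - z‖) (by fun_prop) (a := 0)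
    fun x hx ↦ norm_pos_iff.2 (sub_ne_zero.2 fun h ↦ hx.2 (hzN x h))
  refine ⟨min (min 1 (1 / (2 * K))) (m / (1 + R)), by positivity, fun x hx ↦ ?_⟩
  set η := min (min 1 (1 / (2 * K))) (m / (1 + R))
  have h₁ : η ≤ 1 := (min_le_left _ _).trans (min_le_left _ _)
  have h₂ : η ≤ 1 / (2 * K) := (min_le_left _ _).trans (min_le_right _ _)
  have h₃ : η ≤ m / (1 + R) := min_le_right _ _
  by_cases hxR : ‖x‖ ≤ R
  · calc η * (1 + ‖x‖) ≤ m / (1 + R) * (1 + R) := by gcongr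
      _ = m := by field_simp
      _ ≤ ‖G x - z‖ := hmle x ⟨by simpa using hxR, hx⟩
  · have h₄ : ‖x‖ / K ≤ ‖G x‖ + 1 := by
      rw [div_le_iff₀ hKpos, mul_comm]
      exact hK x
    have h₅ : 2 + ‖z‖ ≤ ‖x‖ / (2 * K) := by
      rw [le_div_iff₀ (by positivity)]
      linarith
    have h₆ : ‖x‖ / K = ‖x‖ / (2 * K) + ‖x‖ / (2 * K) := by
      field_simp
      norm_num
    have h₇ : η * ‖x‖ ≤ ‖x‖ / (2 * K) := by
      calc η * ‖x‖ ≤ 1 / (2 * K) * ‖x‖ := by gcongr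
        _ = ‖x‖ / (2 * K) := by ring
    have h₈ := norm_sub_norm_le (G x) z
    linarith

lemma Finset.eventually_pairwiseDisjoint_ball {M : Type*} [MetricSpace M] (X : Finset M) :
    ∀ᶠ r in 𝓝[>] (0 : ℝ), (X : Set M).PairwiseDisjoint fun x ↦ Metric.ball x r := by
  simp only [Set.PairwiseDisjoint, Set.Pairwise]
  refine (X.eventually_all).2 fun x _ ↦ (X.eventually_all).2 fun y _ ↦ ?_
  by_cases hxy : x = y
  · simp [hxy]
  · have h : 0 < dist x y / 2 := half_pos (dist_pos.2 hxy)
    filter_upwards [Ioo_mem_nhdsGT h] with r hr _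
    exact Metric.ball_disjoint_ball (by linarith [hr.2])

/-- Along a line whose fibres all consist of two-sided affine points, the signed count is
constant up to isolated parameters. -/
lemma exists_eventually_signedCount_eq [FiniteDimensional ℝ E] {G : E → E} (hG : Continuous G)
    {K : ℝ} (hK : ∀ x, ‖x‖ ≤ K * (‖G x‖ + 1)) (hfin : ∀ z, (G ⁻¹' {z}).Finite) {z v : E}
    (hgood : ∀ t : ℝ, ∀ x, G x = z + t • v → TwoSidedAffineAt G v x) :
    ∃ c, ∀ t₀ : ℝ, ∀ᶠ t in 𝓝[≠] t₀, signedCount G univ (z + t • v) = c := by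
  have hlocal : ∀ t₀ : ℝ, ∃ c, ∀ᶠ t in 𝓝[≠] t₀, signedCount G univ (z + t • v) = c := by
    intro t₀
    set X := (hfin (z + t₀ • v)).toFinset with hX
    have hmem : ∀ x, x ∈ X ↔ G x = z + t₀ • v := by simp [hX]
    obtain ⟨r, ⟨hr, hdisj⟩, hr0⟩ := ((X.eventually_all.2 fun x hx ↦
      (hgood t₀ x ((hmem x).1 hx)).eventually_signedCount hfin).and
        X.eventually_pairwiseDisjoint_ball |>.and self_mem_nhdsWithin).exists
    have hr0 : 0 < r := hr0
    choose! e he using hr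
    obtain ⟨η, hη, hsep⟩ := exists_mul_one_add_norm_le hG hK (z := z + t₀ • v)
      (N := ⋃ x ∈ X, Metric.ball x r) (isOpen_biUnion fun _ _ ↦ Metric.isOpen_ball)
      fun x hx ↦ mem_biUnion (s := {x | x ∈ X}) ((hmem x).2 hx) (Metric.mem_ball_self hr0)
    refine ⟨∑ x ∈ X, e x, ?_⟩
    have hshift : Tendsto (fun t : ℝ ↦ t - t₀) (𝓝[≠] t₀) (𝓝[≠] 0) := by
      refine tendsto_nhdsWithin_of_tendsto_nhds_of_eventually_within _ ?_ ?_
      · have : Continuous fun t : ℝ ↦ t - t₀ := by fun_prop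
        exact (this.tendsto' t₀ 0 (sub_self _)).mono_left nhdsWithin_le_nhds
      · filter_upwards [self_mem_nhdsWithin] with t ht
        exact sub_ne_zero.2 ht
    have hclose : ∀ᶠ t : ℝ in 𝓝[≠] t₀, ‖(z + t • v) - (z + t₀ • v)‖ < η := by
      have hc : Continuous fun t : ℝ ↦ ‖(z + t • v) - (z + t₀ • v)‖ := by fun_prop
      exact ((hc.tendsto' t₀ 0 (by simp)).eventually_lt_const hη).filter_mono nhdsWithin_le_nhds
    filter_upwards [X.eventually_all.2 fun x hx ↦ hshift.eventually (he x hx), hclose] with t ht hc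
    rw [signedCount_biUnion X (fun x ↦ Metric.ball x r) hdisj (hfin _)]
    · refine Finset.sum_congr rfl fun x hx ↦ ?_
      rw [← ht x hx, (hmem x).1 hx]
      congr 1
      module
    · intro x hx
      by_contra! hxN
      have := hsep x (by simpa using hxN)
      rw [hx] at this
      nlinarith [norm_nonneg x]
  choose c hc using hlocal
  have hconst : IsLocallyConstant c := by
    rw [IsLocallyConstant.iff_eventually_eq]
    intro t₀
    have h₁ := (eventually_eventually_nhdsWithin.2 (hc t₀))
    rw [eventually_nhdsWithin_iff] at h₁
    filter_upwards [h₁] with t ht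
    by_cases htt : t = t₀
    · rw [htt]
    · have h₂ : ∀ᶠ s in 𝓝[≠] t, signedCount G univ (z + s • v) = c t₀ := by
        have h₃ := ht htt
        rw [isOpen_compl_singleton.nhdsWithin_eq htt] at h₃
        exact h₃.filter_mono nhdsWithin_le_nhds
      obtain ⟨s, hs₁, hs₂⟩ := ((hc t).and h₂).exists
      exact hs₁.symm.trans hs₂
  exact ⟨c 0, fun t₀ ↦ hconst.apply_eq_of_preconnectedSpace t₀ 0 ▸ hc t₀⟩

/-- `G` is affine with invertible linear part on each of finitely many polyhedra covering the
space; the `i`-th polyhedron is cut out by the inequalities `a k x ≤ c k` for `k ∈ T i`. -/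
structure NonsingularPieces (G : E → E) {ι κ : Type*} (a : κ → E →L[ℝ] ℝ) (c : κ → ℝ)
    (T : ι → Set κ) (A : ι → E ≃L[ℝ] E) (b : ι → E) : Prop where
  cover : ∀ x, ∃ i, ∀ k ∈ T i, a k x ≤ c k
  eq : ∀ i x, (∀ k ∈ T i, a k x ≤ c k) → G x = A i x + b i

namespace NonsingularPieces

variable {G : E → E} {ι κ : Type*} {a : κ → E →L[ℝ] ℝ} {c : κ → ℝ} {T : ι → Set κ}
  {A : ι → E ≃L[ℝ] E} {b : ι → E}

lemma finite_preimage [Finite ι] (h : NonsingularPieces G a c T A b) (z : E) :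
    (G ⁻¹' {z}).Finite := by
  refine (Set.finite_range fun i ↦ (A i).symm (z - b i)).subset fun x hx ↦ ?_
  obtain ⟨i, hi⟩ := h.cover x
  refine ⟨i, ?_⟩
  have hx : G x = z := hx
  simp [← hx, h.eq i x hi]

lemma eq_add (h : NonsingularPieces G a c T A b) {i : ι} {x₀ x : E}
    (hx₀ : ∀ k ∈ T i, a k x₀ ≤ c k) (hx : ∀ k ∈ T i, a k x ≤ c k) :
    G x = G x₀ + A i (x - x₀) := by
  rw [h.eq i x hx, h.eq i x₀ hx₀, map_sub]
  abel

variable [Finite κ]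

lemma exists_halfspace_subset (h : NonsingularPieces G a c T A b) {x₀ : E} {α : E →L[ℝ] ℝ}
    (hα : α ≠ 0) (htight : ∀ k, a k x₀ = c k → ∃ l : ℝ, a k = l • α) :
    ∃ i, (∀ k ∈ T i, a k x₀ ≤ c k) ∧
      ∀ᶠ x in 𝓝 x₀, 0 ≤ α (x - x₀) → ∀ k ∈ T i, a k x ≤ c k := by
  have hev : ∀ᶠ x in 𝓝 x₀, ∀ k, (a k x₀ < c k → a k x < c k) ∧ (c k < a k x₀ → c k < a k x) := by
    refine eventually_all.2 fun k ↦ ?_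
    have hk : Tendsto (a k) (𝓝 x₀) (𝓝 (a k x₀)) := (a k).continuous.continuousAt
    refine Eventually.and ?_ ?_
    · by_cases h : a k x₀ < c k
      · exact (hk.eventually_lt_const h).mono fun _ h _ ↦ h
      · simp [h]
    · by_cases h : c k < a k x₀
      · exact (hk.eventually_const_lt h).mono fun _ h _ ↦ h
      · simp [h]
  obtain ⟨e, he⟩ : ∃ e, 0 < α e := by
    obtain ⟨e, he⟩ : ∃ e, α e ≠ 0 := by
      by_contra! h
      exact hα (ContinuousLinearMap.ext h)
    rcases he.lt_or_gt with h | h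
    exacts [⟨-e, by simpa using h⟩, ⟨e, h⟩]
  have hline : ∀ᶠ s : ℝ in 𝓝[>] 0, ∀ k, (a k x₀ < c k → a k (x₀ + s • e) < c k) ∧
      (c k < a k x₀ → c k < a k (x₀ + s • e)) := by
    have hc : Continuous fun s : ℝ ↦ x₀ + s • e := by fun_prop
    exact ((hc.tendsto' 0 x₀ (by simp)).eventually hev).filter_mono nhdsWithin_le_nhds
  obtain ⟨s, hs, hs0⟩ := (hline.and self_mem_nhdsWithin).exists
  have hs0 : 0 < s := hs0
  obtain ⟨i, hi⟩ := h.cover (x₀ + s • e)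
  have hx₀ : ∀ k ∈ T i, a k x₀ ≤ c k := fun k hk ↦
    not_lt.1 fun h ↦ ((hs k).2 h).not_ge (hi k hk)
  refine ⟨i, hx₀, ?_⟩
  filter_upwards [hev] with x hx hpos k hk
  rcases (hx₀ k hk).lt_or_eq with hlt | heq
  · exact ((hx k).1 hlt).le
  · obtain ⟨l, hl⟩ := htight k heq
    have h₁ := hi k hk
    rw [← heq, map_add, add_le_iff_nonpos_right, hl] at h₁
    have hl0 : l ≤ 0 := by
      by_contra! hl0
      have : 0 < l * (s * α e) := by positivity
      simp only [map_smul, smul_apply, smul_eq_mul] at h₁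
      linarith
    have h₂ : a k (x - x₀) ≤ 0 := by
      rw [hl]
      exact mul_nonpos_of_nonpos_of_nonneg hl0 hpos
    rw [map_sub] at h₂
    linarith

lemma twoSidedAffineAt (h : NonsingularPieces G a c T A b) {v x₀ : E} (hv : v ≠ 0)
    (hrank : ∀ k l, a k x₀ = c k → a l x₀ = c l → a k ≠ 0 → ∃ m : ℝ, a l = m • a k)
    (htrans : ∀ k i, a k ≠ 0 → a k x₀ = c k → G x₀ = A i x₀ + b i → a k ((A i).symm v) ≠ 0) :
    TwoSidedAffineAt G v x₀ := by
  by_cases hk : ∃ k, a k ≠ 0 ∧ a k x₀ = c k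
  · obtain ⟨k, hk0, hk⟩ := hk
    obtain ⟨i, hi, hxi⟩ := h.exists_halfspace_subset hk0 fun l hl ↦ hrank k l hk hl hk0
    obtain ⟨j, hj, hxj⟩ := h.exists_halfspace_subset (neg_ne_zero.2 hk0) fun l hl ↦ by
      obtain ⟨m, hm⟩ := hrank k l hk hl hk0
      exact ⟨-m, by rw [hm, neg_smul_neg]⟩
    refine ⟨a k, A i, A j, htrans k i hk0 hk (h.eq i x₀ hi), ?_⟩
    filter_upwards [hxi, hxj] with x hx hx'
    exact ⟨fun h₁ ↦ h.eq_add hi (hx h₁), fun h₁ ↦ h.eq_add hj (hx' (by simpa using h₁))⟩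
  · push Not at hk
    obtain ⟨i, hi⟩ := h.cover x₀
    obtain ⟨α, hα⟩ := SeparatingDual.exists_ne_zero (R := ℝ)
      ((A i).symm.map_ne_zero_iff.2 hv)
    have hev : ∀ᶠ x in 𝓝 x₀, ∀ k, k ∈ T i → a k x ≤ c k := by
      refine eventually_all.2 fun k ↦ ?_
      by_cases hkT : k ∈ T i
      · rcases (hi k hkT).lt_or_eq with hlt | heq
        · exact ((a k).continuous.continuousAt.eventually_lt_const hlt).mono fun _ h _ ↦ h.le
        · have hk0 : a k = 0 := by
            by_contra h0
            exact hk k h0 heq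
          rw [← heq]
          simp [hk0]
      · simp [hkT]
    refine ⟨α, A i, A i, hα, ?_⟩
    filter_upwards [hev] with x hx
    exact ⟨fun _ ↦ h.eq_add hi hx, fun _ ↦ h.eq_add hi hx⟩

end NonsingularPieces

lemma dense_forall_apply_ne [FiniteDimensional ℝ E] {J : Type*} [Finite J]
    (ψ : J → E →L[ℝ] ℝ) (d : J → ℝ) : Dense {z | ∀ j, ψ j ≠ 0 → ψ j z ≠ d j} := by
  have : CompleteSpace E := FiniteDimensional.complete ℝ E
  have hset : {z | ∀ j, ψ j ≠ 0 → ψ j z ≠ d j} = ⋂ j, {z | ψ j ≠ 0 → ψ j z ≠ d j} := by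
    ext z
    simp
  have hcount : Countable J := Finite.to_countable
  rw [hset]
  refine dense_iInter_of_isOpen (fun j ↦ ?_) fun j ↦ ?_ <;> by_cases hj : ψ j = 0
  · simp [hj]
  · simpa [hj] using isOpen_ne_fun (ψ j).continuous continuous_const
  · simp [hj]
  · simp only [ne_eq, hj, not_false_eq_true, true_imp_iff]
    exact (dense_compl_singleton (d j)).preimage ((ψ j).isOpenMap_of_ne_zero hj)

lemma NonsingularPieces.dense_twoSidedAffineAt [FiniteDimensional ℝ E] {G : E → E}
    {ι κ : Type*} [Finite ι] [Finite κ] {a : κ → E →L[ℝ] ℝ} {c : κ → ℝ} {T : ι → Set κ}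
    {A : ι → E ≃L[ℝ] E} {b : ι → E} (h : NonsingularPieces G a c T A b) {v : E} (hv : v ≠ 0) :
    Dense {z | ∀ t : ℝ, ∀ x, G x = z + t • v → TwoSidedAffineAt G v x} := by
  classical
  let w : ι → E := fun i ↦ (A i).symm v
  let φ : ι × κ × κ → E →L[ℝ] ℝ := fun ⟨i, k, l⟩ ↦
    if a k (w i) = 0 then a k else a l (w i) • a k - a k (w i) • a l
  let d : ι × κ × κ → ℝ := fun ⟨i, k, l⟩ ↦
    if a k (w i) = 0 then c k else a l (w i) * c k - a k (w i) * c l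
  refine (dense_forall_apply_ne (fun j ↦ φ j ∘L ((A j.1).symm : E →L[ℝ] E))
    fun j ↦ d j + φ j ((A j.1).symm (b j.1))).mono fun z hz t x hx ↦ ?_
  have hzero : ∀ i k l, G x = A i x + b i → a k x = c k → a l x = c l → φ (i, k, l) = 0 := by
    intro i k l hi hk hl
    by_contra hφ
    refine hz (i, k, l) (fun h0 ↦ hφ ?_) ?_
    · ext y
      simpa using DFunLike.congr_fun h0 (A i y)
    · have hzi : (A i).symm z = x + (A i).symm (b i) - t • w i := by
        rw [(A i).symm_apply_eq]
        simp only [w, map_sub, map_add, map_smul, ContinuousLinearEquiv.apply_symm_apply]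
        rw [← hi, hx, add_sub_cancel_right]
      have hw : φ (i, k, l) (w i) = 0 := by
        by_cases h0 : a k (w i) = 0
        · simp [φ, h0]
        · simp [φ, h0]
          ring
      have hd : φ (i, k, l) x = d (i, k, l) := by
        by_cases h0 : a k (w i) = 0
        · simp [φ, d, h0, hk]
        · simp [φ, d, h0, hk, hl]
      simp only [ContinuousLinearMap.comp_apply, ContinuousLinearEquiv.coe_coe, hzi, map_sub,
        map_add, map_smul, hw, hd]
      simp
  have htrans : ∀ k i, a k ≠ 0 → a k x = c k → G x = A i x + b i → a k (w i) ≠ 0 := by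
    intro k i hk0 hk hi h0
    have := hzero i k k hi hk hk
    simp only [φ, h0, if_true] at this
    exact hk0 this
  refine h.twoSidedAffineAt hv (fun k l hk hl hk0 ↦ ?_) htrans
  obtain ⟨i, hi⟩ := h.cover x
  have hw := htrans k i hk0 hk (h.eq i x hi)
  have h₁ := hzero i k l (h.eq i x hi) hk hl
  simp only [φ, if_neg hw, sub_eq_zero] at h₁
  exact ⟨(a k (w i))⁻¹ * a l (w i), by rw [mul_smul, h₁, inv_smul_smul₀ hw]⟩

lemma ContinuousLinearMap.eventually_det_add_smul_id_ne_zero [FiniteDimensional ℝ E]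
    (L : E →L[ℝ] E) :
    ∀ᶠ ε in 𝓝[>] (0 : ℝ), (L + ε • ContinuousLinearMap.id ℝ E).det ≠ 0 := by
  have hfin : {ε : ℝ | (-L : E →ₗ[ℝ] E).charpoly.IsRoot ε}.Finite :=
    Polynomial.finite_setOfPred_isRoot (LinearMap.charpoly_monic _).ne_zero
  have h₁ : ∀ᶠ ε in 𝓝[>] (0 : ℝ), ε ∉ {ε : ℝ | (-L : E →ₗ[ℝ] E).charpoly.IsRoot ε} :=
    nhdsWithin_mono 0 (fun _ hx ↦ ne_of_gt hx) (nhdsNE_le_cofinite 0 hfin.compl_mem_cofinite)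
  filter_upwards [h₁] with ε hε h0
  refine hε ?_
  rw [Polynomial.IsRoot, LinearMap.eval_charpoly, ← h0, ContinuousLinearMap.det]
  congr 1
  ext x
  simp [add_comm]

lemma ContinuousLinearEquiv.eventually_exists_add_smul [FiniteDimensional ℝ E] (D : E ≃L[ℝ] E)
    (R : ℝ) {r : ℝ} (hr : 0 < r) :
    ∀ᶠ ε in 𝓝[>] (0 : ℝ), ∃ D' : E ≃L[ℝ] E, (∀ u, D' u = D u + ε • u) ∧
      Real.sign (D' : E →L[ℝ] E).det = Real.sign (D : E →L[ℝ] E).det ∧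
      ∀ q, ‖q‖ ≤ ε * R → ‖D'.symm q‖ < r := by
  set M := ‖(D.symm : E →L[ℝ] E)‖
  have hD : (D : E →L[ℝ] E).det ≠ 0 := (LinearEquiv.isUnit_det' D.toLinearEquiv).ne_zero
  have hdet : ∀ᶠ ε in 𝓝[>] (0 : ℝ),
      0 < ((D : E →L[ℝ] E) + ε • ContinuousLinearMap.id ℝ E).det * (D : E →L[ℝ] E).det := by
    have hc : Continuous fun ε : ℝ ↦
        ((D : E →L[ℝ] E) + ε • ContinuousLinearMap.id ℝ E).det * (D : E →L[ℝ] E).det :=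
      (ContinuousLinearMap.continuous_det.comp (by fun_prop)).mul continuous_const
    exact (continuousAt_const.eventually_lt hc.continuousAt
      (by simpa using mul_self_pos.2 hD)).filter_mono nhdsWithin_le_nhds
  have hM : ∀ᶠ ε in 𝓝[>] (0 : ℝ), ε * M < 1 / 2 := by
    have hc : Continuous fun ε : ℝ ↦ ε * M := by fun_prop
    exact (hc.continuousAt.eventually_lt continuousAt_const (by norm_num)).filter_mono
      nhdsWithin_le_nhds
  have hR : ∀ᶠ ε in 𝓝[>] (0 : ℝ), 2 * M * (ε * R) < r := by
    have hc : Continuous fun ε : ℝ ↦ 2 * M * (ε * R) := by fun_prop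
    exact (hc.continuousAt.eventually_lt continuousAt_const (by simpa using hr)).filter_mono
      nhdsWithin_le_nhds
  filter_upwards [hdet, hM, hR, self_mem_nhdsWithin] with ε hε hεM hεR hε0
  have hε0 : 0 < ε := hε0
  have hne := left_ne_zero_of_mul hε.ne'
  refine ⟨ContinuousLinearMap.toContinuousLinearEquivOfDetNeZero _ hne, fun u ↦ by simp, ?_,
    fun q hq ↦ ?_⟩
  · rw [ContinuousLinearMap.coe_toContinuousLinearEquivOfDetNeZero]
    rcases mul_pos_iff.1 hε with ⟨h₁, h₂⟩ | ⟨h₁, h₂⟩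
    · rw [Real.sign_of_pos h₁, Real.sign_of_pos h₂]
    · rw [Real.sign_of_neg h₁, Real.sign_of_neg h₂]
  · set D' := ContinuousLinearMap.toContinuousLinearEquivOfDetNeZero _ hne
    set u := D'.symm q
    have hu : D u = q - ε • u := by
      have : D' u = D u + ε • u := by simp [D']
      rw [← D'.apply_symm_apply q]
      exact eq_sub_of_add_eq this.symm
    have h₁ : ‖u‖ ≤ M * (ε * R + ε * ‖u‖) := by
      calc ‖u‖ = ‖(D.symm : E →L[ℝ] E) (q - ε • u)‖ := by rw [← hu]; simp
        _ ≤ M * ‖q - ε • u‖ := ContinuousLinearMap.le_opNorm _ _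
        _ ≤ M * (ε * R + ε * ‖u‖) := by
          gcongr
          refine (norm_sub_le _ _).trans ?_
          rw [norm_smul, Real.norm_of_nonneg hε0.le]
          gcongr
    nlinarith [norm_nonneg u]

/-- A regular solution of a piecewise affine equation has a neighbourhood on which the map
is affine. -/
lemma eventually_eq_add_fderiv {F : E → E} {ι : Type*} [Finite ι] {P : ι → Set E}
    (hcover : ∀ x, ∃ i, x ∈ P i) (hclosed : ∀ i, IsClosed (P i)) (hconv : ∀ i, Convex ℝ (P i))
    (hint : ∀ i, (interior (P i)).Nonempty) {L : ι → E →L[ℝ] E} {b : ι → E}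
    (heq : ∀ i, ∀ x ∈ P i, F x = L i x + b i) {x₀ : E} (hd : DifferentiableAt ℝ F x₀) :
    ∀ᶠ x in 𝓝 x₀, F x = F x₀ + fderiv ℝ F x₀ (x - x₀) := by
  have hev : ∀ᶠ x in 𝓝 x₀, ∀ i, x ∈ P i → x₀ ∈ P i := by
    refine eventually_all.2 fun i ↦ ?_
    by_cases hi : x₀ ∈ P i
    · simp [hi]
    · filter_upwards [(hclosed i).isOpen_compl.mem_nhds hi] with x hx hx'
      exact absurd hx' hx
  filter_upwards [hev] with x hx
  obtain ⟨i, hi⟩ := hcover x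
  have hi₀ := hx i hi
  have hL : HasFDerivWithinAt F (L i) (P i) x₀ :=
    ((L i).hasFDerivWithinAt.add_const (b i)).congr (heq i) (heq i x₀ hi₀)
  rw [(uniqueDiffOn_convex (hconv i) (hint i)).eq hi₀ hd.hasFDerivAt.hasFDerivWithinAt hL,
    heq i x hi, heq i x₀ hi₀, map_sub]
  abel

theorem surjective_of_signedCount_ne_zero [FiniteDimensional ℝ E] {F : E → E}
    (hF : Continuous F) {K : ℝ} (hK : ∀ x, ‖x‖ ≤ K * (‖F x‖ + 1)) {ι κ : Type*} [Finite ι]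
    [Finite κ] {a : κ → E →L[ℝ] ℝ} {c : κ → ℝ} {T : ι → Set κ} {L : ι → E →L[ℝ] E} {b : ι → E}
    (hcover : ∀ x, ∃ i, ∀ k ∈ T i, a k x ≤ c k)
    (heq : ∀ i x, (∀ k ∈ T i, a k x ≤ c k) → F x = L i x + b i)
    (hint : ∀ i, (interior {x | ∀ k ∈ T i, a k x ≤ c k}).Nonempty) {y : E}
    (hreg : ∀ x, F x = y → DifferentiableAt ℝ F x ∧ (fderiv ℝ F x).det ≠ 0)
    (hcount : signedCount F univ y ≠ 0) : Function.Surjective F := by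
  by_contra hsurj
  obtain ⟨y', hy'⟩ : ∃ y', ∀ x, F x ≠ y' := by
    simpa [Function.Surjective] using hsurj
  have hv : y' - y ≠ 0 := by
    intro h
    rw [sub_eq_zero] at h
    exact hcount (signedCount_eq_zero fun x _ ↦ h ▸ hy' x)
  have hXfin : (F ⁻¹' {y}).Finite := by
    by_contra hinf
    refine hcount (finsum_mem_eq_zero_of_infinite ?_)
    refine Set.Infinite.mono (fun x hx ↦ ⟨⟨trivial, hx⟩, ?_⟩) hinf
    have := (hreg x hx).2
    simpa [Real.sign_eq_zero_iff] using this
  set X := hXfin.toFinset with hX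
  have hmem : ∀ x, x ∈ X ↔ F x = y := by simp [hX]
  have hlocal : ∀ x ∈ X, ∃ D : E ≃L[ℝ] E, (D : E →L[ℝ] E) = fderiv ℝ F x ∧
      ∀ᶠ x' in 𝓝 x, F x' = y + D (x' - x) := by
    intro x hx
    obtain ⟨hd, hdet⟩ := hreg x ((hmem x).1 hx)
    refine ⟨(fderiv ℝ F x).toContinuousLinearEquivOfDetNeZero hdet, by simp, ?_⟩
    have := eventually_eq_add_fderiv (P := fun i ↦ {x | ∀ k ∈ T i, a k x ≤ c k}) hcover
      (fun i ↦ ?_) (fun i ↦ ?_) hint heq hd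
    · simpa [(hmem x).1 hx] using this
    · simp only [ofPred_forall]
      exact isClosed_biInter fun k _ ↦ isClosed_le (a k).continuous continuous_const
    · simp only [ofPred_forall]
      exact convex_iInter₂ fun k _ ↦ convex_halfSpace_le (a k).isLinear (c k)
  choose! D hDF hD using hlocal
  have hsum : signedCount F univ y = ∑ x ∈ X, Real.sign (D x : E →L[ℝ] E).det := by
    have hset : univ ∩ F ⁻¹' {y} = (X : Set E) := by simp [hX]
    rw [signedCount, hset, finsum_mem_coe_finset]
    exact Finset.sum_congr rfl fun x hx ↦ by rw [hDF x hx]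
  have hball : ∀ x ∈ X, ∀ᶠ r in 𝓝[>] (0 : ℝ),
      ∀ x' ∈ Metric.ball x r, F x' = y + D x (x' - x) := by
    intro x hx
    obtain ⟨R, hR, hFR⟩ := Metric.eventually_nhds_iff_ball.1 (hD x hx)
    filter_upwards [Ioo_mem_nhdsGT hR] with r hr x' hx'
    exact hFR x' (Metric.ball_subset_ball hr.2.le hx')
  obtain ⟨r, ⟨hr, hdisj⟩, hr0⟩ := ((X.eventually_all.2 hball).and
    X.eventually_pairwiseDisjoint_ball |>.and self_mem_nhdsWithin).exists
  have hr0 : 0 < r := hr0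
  obtain ⟨η₁, hη₁, hsep₁⟩ := exists_mul_one_add_norm_le hF hK (z := y)
    (N := ⋃ x ∈ X, Metric.ball x r) (isOpen_biUnion fun _ _ ↦ Metric.isOpen_ball)
    fun x hx ↦ mem_biUnion (s := {x | x ∈ X}) ((hmem x).2 hx) (Metric.mem_ball_self hr0)
  obtain ⟨η₂, hη₂, hsep₂⟩ := exists_mul_one_add_norm_le hF hK (z := y') isOpen_empty
    fun x hx ↦ absurd hx (hy' x)
  have hKε : ∀ᶠ ε in 𝓝[>] (0 : ℝ), K * ε < 1 / 2 := by
    have hc : Continuous fun ε : ℝ ↦ K * ε := by fun_prop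
    exact (hc.continuousAt.eventually_lt continuousAt_const (by norm_num)).filter_mono
      nhdsWithin_le_nhds
  have hη₁ε : ∀ᶠ ε in 𝓝[>] (0 : ℝ), ε ∈ Ioo 0 η₁ := Ioo_mem_nhdsGT hη₁
  have hη₂ε : ∀ᶠ ε in 𝓝[>] (0 : ℝ), ε ∈ Ioo 0 η₂ := Ioo_mem_nhdsGT hη₂
  have hDε := X.eventually_all.2 fun x _ ↦ (D x).eventually_exists_add_smul (1 + ‖x‖) hr0
  have hLε := eventually_all.2 fun i ↦ (L i).eventually_det_add_smul_id_ne_zero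
  obtain ⟨ε, hD', hL, hε₁, hε₂, hε₃⟩ :=
    (hDε.and (hLε.and (hη₁ε.and (hη₂ε.and hKε)))).exists
  have hε0 : 0 < ε := hε₁.1
  choose! D' hD'add hD'sign hD'symm using hD'
  set G : E → E := fun x ↦ F x + ε • x with hG
  have hGcont : Continuous G := by fun_prop
  have hpieces : NonsingularPieces G a c T
      (fun i ↦ ContinuousLinearMap.toContinuousLinearEquivOfDetNeZero _ (hL i)) b := by
    refine ⟨hcover, fun i x hx ↦ ?_⟩
    simp only [hG, heq i x hx, ContinuousLinearMap.toContinuousLinearEquivOfDetNeZero_apply,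
      add_apply, smul_apply, ContinuousLinearMap.id_apply]
    abel
  have hGK : ∀ x, ‖x‖ ≤ (2 * |K|) * (‖G x‖ + 1) := by
    intro x
    have h₁ : ‖F x‖ ≤ ‖G x‖ + ε * ‖x‖ := by
      have : F x = G x - ε • x := by simp [hG]
      rw [this]
      refine (norm_sub_le _ _).trans ?_
      rw [norm_smul, Real.norm_of_nonneg hε0.le]
    rcases le_total 0 K with hK0 | hK0
    · rw [abs_of_nonneg hK0]
      nlinarith [hK x, norm_nonneg x, mul_le_mul_of_nonneg_left h₁ hK0]
    · have h₂ : ‖x‖ ≤ 0 :=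
        (hK x).trans (mul_nonpos_of_nonpos_of_nonneg hK0 (by positivity))
      exact h₂.trans (by positivity)
  have hFz : ∀ w z x, ‖z - w‖ < ε → G x = z → ‖F x - w‖ ≤ ε * (1 + ‖x‖) := by
    intro w z x hz hx
    have : F x - w = (z - w) - ε • x := by
      rw [← hx]
      simp only [hG]
      abel
    rw [this]
    refine (norm_sub_le _ _).trans ?_
    rw [norm_smul, Real.norm_of_nonneg hε0.le]
    linarith
  have hnear : ∀ z, ‖z - y‖ < ε → signedCount G univ z = signedCount F univ y := by
    classical
    intro z hz
    rw [hsum, signedCount_biUnion X (fun x ↦ Metric.ball x r) hdisj (hpieces.finite_preimage z)]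
    · refine Finset.sum_congr rfl fun x hx ↦ ?_
      rw [signedCount_affine (A := D' x) (x₀ := x) (w := y + ε • x) Metric.isOpen_ball, if_pos,
        hD'sign x hx]
      · rw [mem_ball_iff_norm, add_sub_cancel_left]
        refine hD'symm x hx _ ?_
        rw [← sub_sub]
        refine (norm_sub_le _ _).trans ?_
        rw [norm_smul, Real.norm_of_nonneg hε0.le]
        linarith
      · intro x' hx'
        simp only [hG, hr x hx x' hx', hD'add x hx]
        module
    · intro x hx
      by_contra! hxN
      have := (hsep₁ x (by simpa using hxN)).trans (hFz y z x hz hx)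
      nlinarith [norm_nonneg x, hε₁.2]
  have hfar : ∀ z, ‖z - y'‖ < ε → signedCount G univ z = 0 := by
    intro z hz
    refine signedCount_eq_zero fun x _ hx ↦ ?_
    have := (hsep₂ x (by simp)).trans (hFz y' z x hz hx)
    nlinarith [norm_nonneg x, hε₂.2]
  obtain ⟨z, hzy, hz⟩ := (hpieces.dense_twoSidedAffineAt hv).exists_dist_lt y hε0 |>.imp
    fun z h ↦ And.intro h.2 h.1
  rw [dist_comm, dist_eq_norm] at hzy
  obtain ⟨e, he⟩ := exists_eventually_signedCount_eq hGcont hGK hpieces.finite_preimage hz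
  have hclose : ∀ (t₀ : ℝ) (w : E), z + t₀ • (y' - y) - w = z - y →
      ∃ t : ℝ, signedCount G univ (z + t • (y' - y)) = e ∧ ‖z + t • (y' - y) - w‖ < ε := by
    intro t₀ w hw
    have hc : Continuous fun t : ℝ ↦ ‖z + t • (y' - y) - w‖ := by fun_prop
    have h₁ : ∀ᶠ t in 𝓝[≠] t₀, ‖z + t • (y' - y) - w‖ < ε :=
      (hc.continuousAt.eventually_lt continuousAt_const (by rwa [hw])).filter_mono
        nhdsWithin_le_nhds
    exact ((he t₀).and h₁).exists
  obtain ⟨t, ht, hty⟩ := hclose 0 y (by simp)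
  obtain ⟨s, hs, hsy⟩ := hclose 1 y' (by module)
  rw [hnear _ hty] at ht
  rw [hfar _ hsy] at hs
  exact hcount (ht.trans hs.symm)

lemma exists_norm_le_of_nonsingularAtInfinity {n : ℕ} {F : (Fin n → ℝ) → (Fin n → ℝ)}
    {S : Finset (Matrix (Fin n) (Fin n) ℝ × (Fin n → ℝ))} {𝒞 : Set (Set (Fin n → ℝ))}
    (h𝒞 : IsSubdivision F S 𝒞) (hns : NonsingularAtInfinity F S 𝒞) :
    ∃ K, ∀ x, ‖x‖ ≤ K * (‖F x‖ + 1) := by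
  obtain ⟨hfin, -, hcover, hact, -⟩ := h𝒞
  have hpiece : ∀ P : 𝒞, ∃ K, ∀ x ∈ P.1, ‖x‖ ≤ K * (‖F x‖ + 1) := by
    rintro ⟨P, hP⟩
    by_cases hb : IsBounded P
    · obtain ⟨R, hR⟩ := hb.exists_norm_le
      refine ⟨|R|, fun x hx ↦ ?_⟩
      calc ‖x‖ ≤ |R| := (hR x hx).trans (le_abs_self R)
        _ ≤ |R| * (‖F x‖ + 1) := le_mul_of_one_le_right (abs_nonneg R) (by simp)
    · obtain ⟨p, hpS, hp⟩ := hact P hP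
      have hdet := hns p hpS P hP hb hp
      set B := LinearMap.toContinuousLinearMap (Matrix.mulVecLin p.1⁻¹)
      refine ⟨‖B‖ * (1 + ‖p.2‖), fun x hx ↦ ?_⟩
      have hBx : x = B (F x - p.2) := by
        simp [B, hp x hx, affMap, Matrix.mulVec_mulVec,
          Matrix.nonsing_inv_mul _ (isUnit_iff_ne_zero.2 hdet)]
      calc ‖x‖ = ‖B (F x - p.2)‖ := by rw [← hBx]
        _ ≤ ‖B‖ * ‖F x - p.2‖ := B.le_opNorm _
        _ ≤ ‖B‖ * ((1 + ‖p.2‖) * (‖F x‖ + 1)) := by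
          gcongr
          nlinarith [norm_sub_le (F x) p.2, norm_nonneg (F x), norm_nonneg p.2,
            mul_nonneg (norm_nonneg (F x)) (norm_nonneg p.2)]
        _ = ‖B‖ * (1 + ‖p.2‖) * (‖F x‖ + 1) := by ring
  choose K hK using hpiece
  have := hfin.to_subtype
  obtain ⟨M, hM⟩ := (Set.finite_range K).bddAbove
  refine ⟨M, fun x ↦ ?_⟩
  obtain ⟨P, hP, hx⟩ : x ∈ ⋃₀ 𝒞 := hcover ▸ mem_univ x
  refine (hK ⟨P, hP⟩ x hx).trans ?_
  gcongr
  exact hM ⟨_, rfl⟩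

/-- A piecewise affine `F : ℝⁿ → ℝⁿ` that is nonsingular at infinity
and has a regular value with nonzero signed preimage count is surjective. -/
theorem surjective_of_nonzero_degree
    {n : ℕ} (F : (Fin n → ℝ) → (Fin n → ℝ))
    (S : Finset (Matrix (Fin n) (Fin n) ℝ × (Fin n → ℝ)))
    (𝒞 : Set (Set (Fin n → ℝ)))
    (hF : IsPWA F S) (h𝒞 : IsSubdivision F S 𝒞)
    (hns : NonsingularAtInfinity F S 𝒞)
    (y : Fin n → ℝ) (hy : IsRegularValue F y) (hdeg : degSum F y ≠ 0) :
    Function.Surjective F := by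
  obtain ⟨K, hK⟩ := exists_norm_le_of_nonsingularAtInfinity h𝒞 hns
  obtain ⟨hfin, hpoly, hcover, hact, -⟩ := h𝒞
  have := hfin.to_subtype
  choose m a c hP using fun P : 𝒞 ↦ (hpoly P.1 P.2).1
  choose p hpS hp using fun P : 𝒞 ↦ hact P.1 P.2
  have hmem : ∀ (P : 𝒞) (x : Fin n → ℝ),
      (∀ k ∈ {k : Σ P : 𝒞, Fin (m P) | k.1 = P},
        (∑ j, a k.1 k.2 j • ContinuousLinearMap.proj (R := ℝ) (φ := fun _ : Fin n ↦ ℝ) j) x ≤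
          c k.1 k.2) ↔ x ∈ P.1 := by
    intro P x
    rw [hP P]
    simp only [mem_ofPred_eq, sum_apply, smul_apply, ContinuousLinearMap.proj_apply, smul_eq_mul]
    exact ⟨fun h i ↦ h ⟨P, i⟩ rfl, fun h ⟨Q, i⟩ hQ ↦ by subst hQ; exact h i⟩
  refine surjective_of_signedCount_ne_zero hF.1 hK
    (a := fun k : Σ P : 𝒞, Fin (m P) ↦
      ∑ j, a k.1 k.2 j • ContinuousLinearMap.proj (R := ℝ) (φ := fun _ : Fin n ↦ ℝ) j)
    (c := fun k ↦ c k.1 k.2) (T := fun P ↦ {k | k.1 = P})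
    (L := fun P ↦ LinearMap.toContinuousLinearMap (Matrix.mulVecLin (p P).1))
    (b := fun P ↦ (p P).2) (fun x ↦ ?_) (fun P x hx ↦ ?_) (fun P ↦ ?_) hy
    (degSum_eq_signedCount F y ▸ hdeg)
  · obtain ⟨P, hPC, hx⟩ : x ∈ ⋃₀ 𝒞 := hcover ▸ mem_univ x
    exact ⟨⟨P, hPC⟩, (hmem ⟨P, hPC⟩ x).2 hx⟩
  · exact hp P x ((hmem P x).1 hx)
  · exact (hpoly P.1 P.2).2.mono (interior_mono fun x hx ↦ (hmem P x).2 hx)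
end
end

section
/- Let F : ℝ^n → ℝ^n be a piecewise affine function that is nonsingular at infinity with respect to a corresponding polyhedral subdivision 𝒫(F). Then F is proper in the sense that ‖F(x)‖ → ∞ as ‖x‖ → ∞ (i.e. the preimage under F of every bounded set is bounded). -/
open Set Filter Bornology

noncomputable section

/-- An affine map with invertible linear part pulls balls back to bounded sets. -/
theorem isBounded_preimage_affMap_ball {n : ℕ}
    (p : Matrix (Fin n) (Fin n) ℝ × (Fin n → ℝ)) (hp : p.1.det ≠ 0) (r : ℝ) :
    IsBounded (affMap p ⁻¹' Metric.ball 0 r) := by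
  have hcont : Continuous fun y : Fin n → ℝ => p.1⁻¹.mulVec (y - p.2) := by fun_prop
  refine ((isCompact_closedBall (0 : Fin n → ℝ) r).image hcont).isBounded.subset fun x hx => ?_
  refine ⟨affMap p x, Metric.ball_subset_closedBall hx, ?_⟩
  simp [affMap, Matrix.mulVec_mulVec, Matrix.nonsing_inv_mul _ (isUnit_iff_ne_zero.mpr hp)]

/-- A piecewise affine `F : ℝⁿ → ℝⁿ` nonsingular at infinity is proper:
`‖F x‖ → ∞` as `‖x‖ → ∞`. -/
theorem proper_of_nonsingular_at_infinity
    {n : ℕ} (F : (Fin n → ℝ) → (Fin n → ℝ))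
    (S : Finset (Matrix (Fin n) (Fin n) ℝ × (Fin n → ℝ)))
    (𝒞 : Set (Set (Fin n → ℝ)))
    (hF : IsPWA F S) (h𝒞 : IsSubdivision F S 𝒞)
    (hns : NonsingularAtInfinity F S 𝒞) :
    Tendsto (fun x => ‖F x‖) (cobounded (Fin n → ℝ)) atTop := by
  rw [tendsto_atTop]
  intro r
  suffices h : IsBounded {x | ‖F x‖ < r} by
    filter_upwards [isBounded_def.mp h] with x hx
    exact not_lt.mp hx
  obtain ⟨hfin, -, hcover, hact, -⟩ := h𝒞
  refine ((isBounded_biUnion hfin).mpr fun P hP => ?_).subset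
    (t := ⋃ P ∈ 𝒞, {x ∈ P | ‖F x‖ < r}) ?_
  · by_cases hb : IsBounded P
    · exact hb.subset fun x hx => hx.1
    · obtain ⟨p, hpS, hp⟩ := hact P hP
      exact (isBounded_preimage_affMap_ball p (hns p hpS P hP hb hp) r).subset
        fun x hx => by simpa [← hp x hx.1] using hx.2
  · intro x hx
    obtain ⟨P, hP, hxP⟩ : x ∈ ⋃₀ 𝒞 := hcover ▸ mem_univ x
    exact mem_biUnion hP ⟨hxP, hx⟩
end
end

section
/- Let F : ℝ^n → ℝ^n be a piecewise affine function and let y ∈ ℝ^n be a regular value of F. Then the preimage F⁻¹(y) is a finite (and discrete) set. -/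
open Set Filter Bornology

noncomputable section

/-- Along each direction, the derivative of a piecewise affine map at a point of differentiability
agrees with the linear part of some selection function taking the right value at that point. -/
lemma exists_selection_fderiv_apply_eq {n : ℕ} {F : (Fin n → ℝ) → (Fin n → ℝ)}
    {S : Finset (Matrix (Fin n) (Fin n) ℝ × (Fin n → ℝ))} (hF : IsPWA F S)
    {x : Fin n → ℝ} (hx : DifferentiableAt ℝ F x) (h : Fin n → ℝ) :
    ∃ p ∈ S, affMap p x = F x ∧ fderiv ℝ F x h = p.1.mulVec h := by
  have hfreq : ∃ p ∈ S, ∃ᶠ t : ℝ in nhdsWithin 0 {0}ᶜ, F (x + t • h) = affMap p (x + t • h) := by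
    by_contra! hcon
    have hall : ∀ᶠ t : ℝ in nhdsWithin 0 {0}ᶜ,
        ∀ p ∈ S, ¬ F (x + t • h) = affMap p (x + t • h) :=
      (Filter.eventually_all_finset S).2 fun p hp => by simpa using hcon p hp
    obtain ⟨t, ht⟩ := hall.exists
    obtain ⟨p, hp, hpt⟩ := hF.2 (x + t • h)
    exact ht p hp hpt
  obtain ⟨p, hp, hpf⟩ := hfreq
  have hcont : Continuous (affMap p) := by
    unfold affMap
    exact (Continuous.matrix_mulVec continuous_const continuous_id).add continuous_const
  have hclosed : IsClosed {t : ℝ | F (x + t • h) = affMap p (x + t • h)} :=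
    isClosed_eq (hF.1.comp (by fun_prop)) (hcont.comp (by fun_prop))
  have hval : F x = affMap p x := by
    simpa using hclosed.mem_of_frequently_of_tendsto hpf
      (tendsto_id.mono_left nhdsWithin_le_nhds)
  have hderiv : HasDerivAt (fun t : ℝ => F (x + t • h)) (fderiv ℝ F x h) 0 :=
    hx.hasFDerivAt.hasLineDerivAt h
  have hslope := hderiv.tendsto_slope_zero
  refine ⟨p, hp, hval.symm, ?_⟩
  have hmem : fderiv ℝ F x h ∈ ({p.1.mulVec h} : Set (Fin n → ℝ)) := by
    refine isClosed_singleton.mem_of_frequently_of_tendsto ?_ hslope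
    refine (hpf.and_eventually self_mem_nhdsWithin).mono fun t ⟨ht, ht0⟩ => ?_
    have ht0 : t ≠ 0 := ht0
    simp [ht, hval, affMap, Matrix.mulVec_add, Matrix.mulVec_smul, smul_smul, ht0]
  exact hmem

/-- The derivative of a piecewise affine map at a point of differentiability is the linear part of
some selection function taking the right value at that point. -/
lemma exists_selection_fderiv_eq {n : ℕ} {F : (Fin n → ℝ) → (Fin n → ℝ)}
    {S : Finset (Matrix (Fin n) (Fin n) ℝ × (Fin n → ℝ))} (hF : IsPWA F S)
    {x : Fin n → ℝ} (hx : DifferentiableAt ℝ F x) :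
    ∃ p ∈ S, affMap p x = F x ∧ ∀ h, fderiv ℝ F x h = p.1.mulVec h := by
  classical
  let T := S.filter fun p => affMap p x = F x
  let V : Matrix (Fin n) (Fin n) ℝ × (Fin n → ℝ) → Subspace ℝ (Fin n → ℝ) :=
    fun p => LinearMap.eqLocus (fderiv ℝ F x : (Fin n → ℝ) →ₗ[ℝ] (Fin n → ℝ)) p.1.mulVecLin
  have hcover : ⋃ p ∈ T, (V p : Set (Fin n → ℝ)) = univ := by
    refine eq_univ_of_forall fun h => ?_
    obtain ⟨p, hp, hpx, hph⟩ := exists_selection_fderiv_apply_eq hF hx h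
    exact mem_biUnion (Finset.mem_coe.2 (Finset.mem_filter.2 ⟨hp, hpx⟩)) hph
  obtain ⟨p, hp, htop⟩ : ∃ p ∈ T, V p = ⊤ := by
    refine Finset.mem_image.1 (Subspace.top_mem_of_biUnion_eq_univ (s := T.image V) ?_)
    rwa [Finset.set_biUnion_finset_image]
  obtain ⟨hpS, hpx⟩ := Finset.mem_filter.1 hp
  refine ⟨p, hpS, hpx, fun h => ?_⟩
  have hh : h ∈ V p := htop ▸ Submodule.mem_top
  exact hh

/-- For a piecewise affine `F : ℝⁿ → ℝⁿ` and a regular value `y`, the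
preimage `F⁻¹(y)` is finite and discrete. -/
theorem preimage_of_regular_value_finite
    {n : ℕ} (F : (Fin n → ℝ) → (Fin n → ℝ))
    (S : Finset (Matrix (Fin n) (Fin n) ℝ × (Fin n → ℝ)))
    (hF : IsPWA F S) (y : Fin n → ℝ) (hy : IsRegularValue F y) :
    (F ⁻¹' {y}).Finite ∧ DiscreteTopology (F ⁻¹' {y} : Set (Fin n → ℝ)) := by
  choose! p hpS hpx hpd using fun x (hx : x ∈ F ⁻¹' {y}) =>
    exists_selection_fderiv_eq hF (hy x hx).1
  have hfin : (F ⁻¹' {y}).Finite := by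
    refine Set.Finite.of_injOn (f := p) (t := S) (fun x hx => hpS x hx) ?_ S.finite_toSet
    intro u hu v hv huv
    have hinj : Function.Injective (fderiv ℝ F u) :=
      (LinearMap.equivOfDetNeZero _ (hy u hu).2).injective
    apply hinj
    have heq : affMap (p u) u = affMap (p u) v := by
      rw [hpx u hu, huv, hpx v hv]
      exact hu.trans hv.symm
    rw [hpd u hu u, hpd u hu v]
    exact add_right_cancel heq
  have := hfin.to_subtype
  exact ⟨hfin, inferInstance⟩
end
end

section
/- Let F : ℝ^n → ℝ^n be a continuous function and let 𝒫 be a finite collection of nonempty n-dimensional convex polyhedra whose union is ℝ^n such that distinct polyhedra of 𝒫 meet in a common proper face or not at all. Suppose that on every unbounded polyhedron of 𝒫, F coincides with an affine function, and that the linear parts of these affine functions all have the same nonzero determinant sign (all determinants positive, or all negative). Then F is surjective. (In particular, no affinity assumption is needed for F on the bounded polyhedra of 𝒫; continuity suffices there.) -/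
open Set Filter Bornology

noncomputable section

open MeasureTheory Topology

/-- The gradients of the components of a self-map of `ℝⁿ`. -/
def gradRows {n : ℕ} (G : (Fin n → ℝ) → (Fin n → ℝ)) (x : Fin n → ℝ) : Fin n → Fin n → ℝ :=
  fun i j => fderiv ℝ G x (Pi.single j 1) i

/-- The Jacobian matrix of a self-map of `ℝⁿ`. -/
def jacobian {n : ℕ} (G : (Fin n → ℝ) → (Fin n → ℝ)) (x : Fin n → ℝ) :
    Matrix (Fin n) (Fin n) ℝ :=
  Matrix.of (gradRows G x)

lemma jacobian_mulVec {n : ℕ} (G : (Fin n → ℝ) → (Fin n → ℝ)) (x v : Fin n → ℝ) :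
    (jacobian G x).mulVec v = fderiv ℝ G x v := by
  have : jacobian G x =
      LinearMap.toMatrix' (fderiv ℝ G x : (Fin n → ℝ) →ₗ[ℝ] (Fin n → ℝ)) := by
    ext i j
    simp [jacobian, gradRows, LinearMap.toMatrix'_apply]
  rw [this, LinearMap.toMatrix'_mulVec]
  rfl

lemma contDiff_gradRows {n : ℕ} {G : (Fin n → ℝ) → (Fin n → ℝ)} (hG : ContDiff ℝ 2 G)
    (i : Fin n) : ContDiff ℝ 1 fun x => gradRows G x i := by
  rw [contDiff_pi]
  intro j
  have h : ContDiff ℝ 1 (fderiv ℝ G) := hG.fderiv_right (by norm_num)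
  exact (contDiff_apply ℝ ℝ i).comp (h.clm_apply contDiff_const)

lemma fderiv_gradRows {n : ℕ} {G : (Fin n → ℝ) → (Fin n → ℝ)} (hG : ContDiff ℝ 2 G)
    (i l : Fin n) (x v : Fin n → ℝ) :
    fderiv ℝ (fun x => gradRows G x i) x v l =
      fderiv ℝ (fderiv ℝ G) x v (Pi.single l 1) i := by
  have h : ContDiff ℝ 1 (fderiv ℝ G) := hG.fderiv_right (by norm_num)
  have h1 : HasFDerivAt (fderiv ℝ G) (fderiv ℝ (fderiv ℝ G) x) x :=
    (h.differentiable (by norm_num) x).hasFDerivAt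
  have h2 := (contDiff_gradRows hG i).differentiable (by norm_num) x
  have h3 := hasFDerivAt_pi'.1 h2.hasFDerivAt l
  have h4 := hasFDerivAt_pi'.1 (h1.clm_apply (hasFDerivAt_const (Pi.single l (1 : ℝ)) x)) i
  have h5 := h3.unique h4
  simpa using DFunLike.congr_fun h5 v

/-- The determinant as a continuous multilinear function of the rows. -/
def detRowContinuous (n : ℕ) : ContinuousMultilinearMap ℝ (fun _ : Fin n => Fin n → ℝ) ℝ where
  toMultilinearMap := (Matrix.detRowAlternating (R := ℝ) (n := Fin n)).toMultilinearMap
  cont := (continuous_id (X := Matrix (Fin n) (Fin n) ℝ)).matrix_det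

lemma sum_detRow_update_update_eq_zero {n : ℕ} (R : Fin n → Fin n → ℝ) {j k : Fin n} (hjk : j ≠ k)
    (H : Fin n → Fin n → ℝ) (hH : ∀ i l, H i l = H l i) :
    ∑ i, detRowContinuous n
      (Function.update (Function.update R k (Pi.single i 1)) j (H i)) = 0 := by
  set T : Fin n → Fin n → ℝ := fun i l => detRowContinuous n
    (Function.update (Function.update R k (Pi.single i 1)) j (Pi.single l 1)) with hT
  have hexp : ∀ i, detRowContinuous n
      (Function.update (Function.update R k (Pi.single i 1)) j (H i)) = ∑ l, H i l * T i l := by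
    intro i
    have : H i = ∑ l, H i l • (Pi.single l 1 : Fin n → ℝ) := by
      ext m; simp [Finset.sum_apply, Pi.single_apply]
    have hmap := (detRowContinuous n).toMultilinearMap.map_update_sum Finset.univ j
      (fun l => H i l • (Pi.single l 1 : Fin n → ℝ)) (Function.update R k (Pi.single i 1))
    simp only [ContinuousMultilinearMap.coe_coe] at hmap
    conv_lhs => rw [this]
    rw [hmap]
    simp [hT]
  have hanti : ∀ i l, T i l = - T l i := by
    intro i l
    have := (Matrix.detRowAlternating (R := ℝ) (n := Fin n)).map_swap
      (Function.update (Function.update R k (Pi.single l 1)) j (Pi.single i 1)) hjk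
    rw [hT]
    change _ = - (Matrix.detRowAlternating (R := ℝ) (n := Fin n)) _
    rw [← this]
    change (Matrix.detRowAlternating (R := ℝ) (n := Fin n)) _ = _
    congr 1
    ext a b
    by_cases ha : a = j
    · subst ha; simp [Function.update_of_ne hjk.symm]
    · by_cases hb : a = k
      · subst hb; simp [Function.update_of_ne ha]
      · simp [Equiv.swap_apply_of_ne_of_ne ha hb, Function.update_of_ne, ha, hb]
  simp only [hexp]
  have h1 : ∑ i, ∑ l, H i l * T i l = ∑ i, ∑ l, -(H i l * T i l) := by
    rw [Finset.sum_comm]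
    refine Finset.sum_congr rfl fun i _ => Finset.sum_congr rfl fun l _ => ?_
    rw [hH l i, hanti l i]; ring
  simp only [Finset.sum_neg_distrib] at h1
  linarith

/-- The `(i, k)` entry of the adjugate of the Jacobian. -/
lemma adjugate_jacobian {n : ℕ} (G : (Fin n → ℝ) → (Fin n → ℝ)) (i k : Fin n) (x : Fin n → ℝ) :
    (jacobian G x).adjugate i k =
      detRowContinuous n (fun j => Function.update (gradRows G x) k (Pi.single i 1) j) := by
  rw [Matrix.adjugate_apply]; rfl

lemma contDiff_update_gradRows {n : ℕ} {G : (Fin n → ℝ) → (Fin n → ℝ)} (hG : ContDiff ℝ 2 G)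
    (k j : Fin n) (u : Fin n → ℝ) :
    ContDiff ℝ 1 fun x => Function.update (gradRows G x) k u j := by
  by_cases h : j = k
  · subst h; simpa using contDiff_const
  · simpa [Function.update_of_ne h] using contDiff_gradRows hG j

lemma contDiff_adjugate_jacobian {n : ℕ} {G : (Fin n → ℝ) → (Fin n → ℝ)} (hG : ContDiff ℝ 2 G)
    (i k : Fin n) : ContDiff ℝ 1 fun x => (jacobian G x).adjugate i k := by
  simp only [adjugate_jacobian]
  exact (detRowContinuous n).contDiff.comp
    (contDiff_pi.2 fun j => contDiff_update_gradRows hG k j _)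

/-- The Piola identity: the columns of the adjugate of a Jacobian matrix are divergence free. -/
lemma sum_fderiv_adjugate_jacobian_eq_zero {n : ℕ} {G : (Fin n → ℝ) → (Fin n → ℝ)}
    (hG : ContDiff ℝ 2 G) (k : Fin n) (x : Fin n → ℝ) :
    ∑ i, fderiv ℝ (fun x => (jacobian G x).adjugate i k) x (Pi.single i 1) = 0 := by
  have hd : ∀ i, fderiv ℝ (fun x => (jacobian G x).adjugate i k) x (Pi.single i 1) =
      ∑ j, if j = k then 0 else detRowContinuous n
        (Function.update (Function.update (gradRows G x) k (Pi.single i 1)) j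
          (fun l => fderiv ℝ (fderiv ℝ G) x (Pi.single i 1) (Pi.single l 1) j)) := by
    intro i
    simp only [adjugate_jacobian]
    have h := HasFDerivAt.multilinear_comp (detRowContinuous n)
      (g := fun j x => Function.update (gradRows G x) k (Pi.single i 1) j)
      (fun j => ((contDiff_update_gradRows hG k j (Pi.single i 1)).differentiable
        (by norm_num) x).hasFDerivAt)
    rw [h.fderiv, sum_apply]
    refine Finset.sum_congr rfl fun j _ => ?_
    simp only [ContinuousLinearMap.comp_apply, ContinuousMultilinearMap.toContinuousLinearMap_apply]
    split_ifs with hj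
    · subst hj
      simp only [Function.update_self, fderiv_fun_const, Pi.zero_apply,
        zero_apply]
      exact (detRowContinuous n).toMultilinearMap.map_update_zero _ j
    · congr 2
      ext l
      rw [← fderiv_gradRows hG]
      simp [Function.update_of_ne hj]
  simp only [hd]
  rw [Finset.sum_comm]
  refine Finset.sum_eq_zero fun j _ => ?_
  split_ifs with hj
  · simp
  · refine sum_detRow_update_update_eq_zero _ hj
      (fun i l => fderiv ℝ (fderiv ℝ G) x (Pi.single i 1) (Pi.single l 1) j) fun i l => ?_
    rw [(hG.contDiffAt.isSymmSndFDerivAt (by simp)).eq]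

lemma contDiff_det_jacobian {n : ℕ} {G : (Fin n → ℝ) → (Fin n → ℝ)} (hG : ContDiff ℝ 2 G) :
    ContDiff ℝ 1 fun x => (jacobian G x).det :=
  (detRowContinuous n).contDiff.comp (contDiff_pi.2 fun j => contDiff_gradRows hG j)

lemma integral_fderiv_comp_mul_det_jacobian_eq_zero {n : ℕ} {G : (Fin n → ℝ) → (Fin n → ℝ)}
    (hG : ContDiff ℝ 2 G) {φ : (Fin n → ℝ) → ℝ} (hφ : ContDiff ℝ 1 φ)
    (hc : HasCompactSupport (φ ∘ G)) (v : Fin n → ℝ) :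
    ∫ x, fderiv ℝ φ (G x) v * (jacobian G x).det = 0 := by
  have hf : ContDiff ℝ 1 (φ ∘ G) := hφ.comp (hG.of_le (by norm_num))
  set g : Fin n → (Fin n → ℝ) → ℝ := fun i x => ((jacobian G x).adjugate.mulVec v) i with hg
  have hgk : ∀ i, g i = fun x => ∑ k, (jacobian G x).adjugate i k * v k := fun i => rfl
  have hgC : ∀ i, ContDiff ℝ 1 (g i) := fun i => by
    rw [hgk]
    exact ContDiff.sum fun k _ => (contDiff_adjugate_jacobian hG i k).mul contDiff_const
  have hdiv : ∀ x, ∑ i, fderiv ℝ (g i) x (Pi.single i 1) = 0 := by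
    intro x
    have : ∀ i, fderiv ℝ (g i) x (Pi.single i 1) =
        ∑ k, v k * fderiv ℝ (fun x => (jacobian G x).adjugate i k) x (Pi.single i 1) := by
      intro i
      have h : HasFDerivAt (g i)
          (∑ k, v k • fderiv ℝ (fun x => (jacobian G x).adjugate i k) x) x := by
        rw [hgk]
        exact HasFDerivAt.fun_sum fun k _ => (((contDiff_adjugate_jacobian hG i k).differentiable
          (by norm_num) x).hasFDerivAt).mul_const (v k)
      rw [h.fderiv]
      simp
    simp only [this]
    rw [Finset.sum_comm]
    simp only [← Finset.mul_sum, sum_fderiv_adjugate_jacobian_eq_zero hG, mul_zero,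
      Finset.sum_const_zero]
  have hpt : ∀ x, fderiv ℝ φ (G x) v * (jacobian G x).det =
      ∑ i, fderiv ℝ (φ ∘ G) x (Pi.single i 1) * g i x := by
    intro x
    have h1 : (jacobian G x).mulVec ((jacobian G x).adjugate.mulVec v) =
        (jacobian G x).det • v := by
      rw [Matrix.mulVec_mulVec, Matrix.mul_adjugate, Matrix.smul_mulVec, Matrix.one_mulVec]
    have h2 : (fun i => g i x) = ∑ i, g i x • (Pi.single i 1 : Fin n → ℝ) := by
      ext m; simp [Finset.sum_apply, Pi.single_apply]
    have h3 : fderiv ℝ (φ ∘ G) x (fun i => g i x) = fderiv ℝ φ (G x) v * (jacobian G x).det := by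
      rw [fderiv_comp x (hφ.differentiable (by norm_num) _) (hG.differentiable (by norm_num) _),
        ContinuousLinearMap.comp_apply, ← jacobian_mulVec]
      change fderiv ℝ φ (G x) ((jacobian G x).mulVec ((jacobian G x).adjugate.mulVec v)) = _
      rw [h1]
      simp [mul_comm]
    rw [← h3, h2, map_sum]
    simp [mul_comm]
  have hcf : Continuous (fderiv ℝ (φ ∘ G)) := hf.continuous_fderiv (by norm_num)
  have hcg : ∀ i, Continuous (fderiv ℝ (g i)) := fun i =>
    (hgC i).continuous_fderiv (by norm_num)
  have hsf : ∀ w, HasCompactSupport fun x => fderiv ℝ (φ ∘ G) x w := fun w =>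
    hc.fderiv_apply (𝕜 := ℝ) w
  have hi1 : ∀ i, Integrable fun x => fderiv ℝ (φ ∘ G) x (Pi.single i 1) * g i x := fun i =>
    ((hcf.clm_apply continuous_const).mul (hgC i).continuous).integrable_of_hasCompactSupport
      (hsf _).mul_right
  have hi2 : ∀ i, Integrable fun x => (φ ∘ G) x * fderiv ℝ (g i) x (Pi.single i 1) := fun i =>
    (hf.continuous.mul ((hcg i).clm_apply continuous_const)).integrable_of_hasCompactSupport
      hc.mul_right
  have hi3 : ∀ i, Integrable fun x => (φ ∘ G) x * g i x := fun i =>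
    (hf.continuous.mul (hgC i).continuous).integrable_of_hasCompactSupport hc.mul_right
  simp only [hpt]
  rw [integral_finsetSum _ fun i _ => hi1 i]
  have hparts : ∀ i, ∫ x, fderiv ℝ (φ ∘ G) x (Pi.single i 1) * g i x =
      - ∫ x, (φ ∘ G) x * fderiv ℝ (g i) x (Pi.single i 1) := fun i => by
    rw [integral_mul_fderiv_eq_neg_fderiv_mul_of_integrable (hi1 i) (hi2 i) (hi3 i)
      (fun x _ => hf.differentiable (by norm_num) x)
      (fun x _ => (hgC i).differentiable (by norm_num) x), neg_neg]
  simp only [hparts]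
  rw [Finset.sum_neg_distrib, ← integral_finsetSum _ fun i _ => hi2 i]
  simp only [← Finset.mul_sum, hdiv, mul_zero, integral_zero, neg_zero]

/-- Invariance of the degree integral of a proper `C²` map under translation of the test
function. -/
lemma integral_comp_sub_mul_det_jacobian {n : ℕ} {G : (Fin n → ℝ) → (Fin n → ℝ)}
    (hG : ContDiff ℝ 2 G) (hprop : ∀ K, IsCompact K → IsCompact (G ⁻¹' K))
    {φ : (Fin n → ℝ) → ℝ} (hφ : ContDiff ℝ 1 φ) (hc : HasCompactSupport φ) (v : Fin n → ℝ) :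
    ∫ x, φ (G x - v) * (jacobian G x).det = ∫ x, φ (G x) * (jacobian G x).det := by
  have hdet := (contDiff_det_jacobian hG).continuous
  have hcomp : ∀ ψ : (Fin n → ℝ) → ℝ, HasCompactSupport ψ → HasCompactSupport (ψ ∘ G) :=
    fun ψ hψ => HasCompactSupport.intro (hprop _ hψ) fun x hx =>
      image_eq_zero_of_notMem_tsupport (f := ψ) hx
  have hshift : ∀ t : ℝ, HasCompactSupport fun y => φ (y - t • v) := fun t =>
    hc.comp_homeomorph (Homeomorph.subRight (t • v))
  have hshiftC : ∀ t : ℝ, ContDiff ℝ 1 fun y => φ (y - t • v) := fun t => by fun_prop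
  have hzero : ∀ t : ℝ, ∫ x, fderiv ℝ φ (G x - t • v) v * (jacobian G x).det = 0 := by
    intro t
    have := integral_fderiv_comp_mul_det_jacobian_eq_zero hG (hshiftC t) (hcomp _ (hshift t)) v
    simpa only [fderiv_comp_sub] using this
  have hcd : Continuous (fderiv ℝ φ) := hφ.continuous_fderiv (by norm_num)
  have hcont : Continuous (Function.uncurry fun (t : ℝ) (x : Fin n → ℝ) =>
      fderiv ℝ φ (G x - t • v) v * (jacobian G x).det) := by
    have hGc := hG.continuous
    have h : Continuous fun p : ℝ × (Fin n → ℝ) => fderiv ℝ φ (G p.2 - p.1 • v) v := by fun_prop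
    exact h.mul (hdet.comp continuous_snd)
  have hftc : ∀ x, ∫ t in (0 : ℝ)..1, fderiv ℝ φ (G x - t • v) v * (jacobian G x).det =
      φ (G x) * (jacobian G x).det - φ (G x - v) * (jacobian G x).det := by
    intro x
    have hder : ∀ t ∈ uIcc (0 : ℝ) 1, HasDerivAt
        (fun t : ℝ => -(φ (G x - t • v) * (jacobian G x).det))
        (fderiv ℝ φ (G x - t • v) v * (jacobian G x).det) t := by
      intro t _
      have h1 : HasDerivAt (fun t : ℝ => G x - t • v) (-v) t := by
        simpa using ((hasDerivAt_id t).smul_const v).const_sub (G x)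
      have h2 := ((hφ.differentiable (by norm_num) (G x - t • v)).hasFDerivAt).comp_hasDerivAt t h1
      convert! (h2.mul_const (jacobian G x).det).neg using 1
      simp
    rw [intervalIntegral.integral_eq_sub_of_hasDerivAt hder]
    · simp; ring
    · exact (hcont.comp (Continuous.prodMk_left x)).intervalIntegrable _ _
  obtain ⟨K, hK, hKsupp⟩ : ∃ K : Set (Fin n → ℝ), IsCompact K ∧
      ∀ t ∈ Icc (0 : ℝ) 1, ∀ x, x ∉ K → fderiv ℝ φ (G x - t • v) v = 0 := by
    refine ⟨G ⁻¹' ((fun p : ℝ × (Fin n → ℝ) => p.2 + p.1 • v) '' (Icc 0 1 ×ˢ tsupport φ)),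
      hprop _ ((isCompact_Icc.prod hc).image (by fun_prop)), fun t ht x hx => ?_⟩
    have : G x - t • v ∉ tsupport φ := fun h => hx ⟨(t, G x - t • v), ⟨ht, h⟩, by simp⟩
    have h0 : fderiv ℝ φ (G x - t • v) = 0 :=
      image_eq_zero_of_notMem_tsupport (fun h => this (tsupport_fderiv_subset ℝ h))
    simp [h0]
  have hint : Integrable (Function.uncurry fun (t : ℝ) (x : Fin n → ℝ) =>
      fderiv ℝ φ (G x - t • v) v * (jacobian G x).det)
      ((volume.restrict (uIoc (0 : ℝ) 1)).prod volume) := by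
    have h1 : IntegrableOn (Function.uncurry fun (t : ℝ) (x : Fin n → ℝ) =>
        fderiv ℝ φ (G x - t • v) v * (jacobian G x).det) (Icc (0 : ℝ) 1 ×ˢ K)
        (volume.prod volume) :=
      hcont.continuousOn.integrableOn_compact (isCompact_Icc.prod hK)
    have h2 := h1.of_forall_sdiff_eq_zero (t := Icc (0 : ℝ) 1 ×ˢ univ)
      (measurableSet_Icc.prod MeasurableSet.univ) (by
        rintro ⟨t, x⟩ ⟨⟨ht, -⟩, hx⟩
        have : x ∉ K := fun h => hx ⟨ht, h⟩
        simp [hKsupp t ht x this])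
    have h3 := h2.mono_set (s := Ioc (0 : ℝ) 1 ×ˢ univ) (prod_mono_left Ioc_subset_Icc_self)
    rw [IntegrableOn, ← Measure.prod_restrict, Measure.restrict_univ] at h3
    rwa [uIoc_of_le zero_le_one]
  have hswap := intervalIntegral_integral_swap hint
  simp only [hzero, hftc, intervalIntegral.integral_zero] at hswap
  have hsc : HasCompactSupport fun x => φ (G x - v) := by
    have h := hcomp _ (hshift 1)
    simp only [one_smul] at h
    exact h
  have hGc := hG.continuous
  have hφc := hφ.continuous
  rw [integral_sub] at hswap
  · linarith
  · exact ((hφc.comp hGc).mul hdet).integrable_of_hasCompactSupport (hcomp φ hc).mul_right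
  · exact (Continuous.mul (by fun_prop) hdet).integrable_of_hasCompactSupport hsc.mul_right

/-- A proper continuous map is surjective if some attained value has all its preimages in an open
set on which the map is `C²` with Jacobian determinant of constant nonzero sign. -/
theorem surjective_of_det_jacobian_pos {n : ℕ} {F : (Fin n → ℝ) → (Fin n → ℝ)}
    (hF : Continuous F) (hprop : ∀ K, IsCompact K → IsCompact (F ⁻¹' K))
    {U : Set (Fin n → ℝ)} (hU : IsOpen U) (hFU : ContDiffOn ℝ 2 F U) (s : ℝ)
    (hs : ∀ x ∈ U, 0 < s * (jacobian F x).det) (x₀ : Fin n → ℝ)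
    (hx₀ : F ⁻¹' {F x₀} ⊆ U) : Function.Surjective F := by
  intro y₁
  by_contra! hy₁
  have hclosed : IsClosedMap F :=
    (isProperMap_iff_isCompact_preimage.2 ⟨hF, fun K hK => hprop K hK⟩).isClosedMap
  obtain ⟨δ, hδ, hδy⟩ := Metric.isOpen_iff.1 (hclosed _ isClosed_univ).isOpen_compl y₁
    (by rintro ⟨x, -, hx⟩; exact hy₁ x hx)
  obtain ⟨r, hr, hry⟩ := Metric.nhds_basis_closedBall.mem_iff.1
    ((hclosed _ hU.isClosed_compl).isOpen_compl.mem_nhds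
      (x := F x₀) (by rintro ⟨x, hx, hxx⟩; exact hx (hx₀ hxx)))
  set K := F ⁻¹' Metric.closedBall (F x₀) r
  have hKU : K ⊆ U := fun x hx => by
    by_contra h
    exact hry hx ⟨x, h, rfl⟩
  have hKc : IsClosed K := Metric.isClosed_closedBall.preimage hF
  set ε := min (r / 2) (δ / 2)
  have hεpos : 0 < ε := by positivity
  obtain ⟨G, hG, hGF, hGK⟩ :
      ∃ G, ContDiff ℝ 2 G ∧ (∀ x, dist (G x) (F x) < ε) ∧ EqOn G F K := by
    obtain ⟨G, hG, hGF, hGK, -⟩ := hF.exists_contDiff_approx_and_eqOn (2 : ℕ∞)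
      (ε := fun _ => ε) continuous_const (fun _ => hεpos) hKc
      (hU.mem_nhdsSet.2 hKU) (by exact_mod_cast hFU)
    exact ⟨G, by exact_mod_cast hG, hGF, hGK⟩
  have hGprop : ∀ L, IsCompact L → IsCompact (G ⁻¹' L) := by
    intro L hL
    have hsub : G ⁻¹' L ⊆ F ⁻¹' Metric.cthickening ε L := by
      intro x hx
      have hd : dist (F x) (G x) ≤ ε := by
        rw [dist_comm]
        exact (hGF x).le
      exact Metric.mem_cthickening_of_dist_le (F x) (G x) ε L hx hd
    exact (hprop _ hL.cthickening).of_isClosed_subset (hL.isClosed.preimage hG.continuous) hsub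
  let φ : ContDiffBump (F x₀) := ⟨ε / 2, ε, by positivity, by linarith⟩
  have hφ0 : ∀ y, ε ≤ dist y (F x₀) → φ y = 0 := fun y hy => φ.zero_of_le_dist hy
  have key := integral_comp_sub_mul_det_jacobian hG hGprop φ.contDiff φ.hasCompactSupport
    (y₁ - F x₀)
  have hz : ∀ x, φ (G x - (y₁ - F x₀)) = 0 := by
    intro x
    refine hφ0 _ ?_
    by_contra! h
    have h1 : dist (G x) y₁ < ε := by
      have e : G x - (y₁ - F x₀) - F x₀ = G x - y₁ := by abel
      rwa [dist_eq_norm, e, ← dist_eq_norm] at h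
    suffices hm : F x ∈ Metric.ball y₁ δ from hδy hm ⟨x, trivial, rfl⟩
    have := hGF x
    have := dist_triangle_left (F x) y₁ (G x)
    have : ε ≤ δ / 2 := min_le_right _ _
    rw [Metric.mem_ball]; linarith
  simp only [hz, zero_mul, integral_zero] at key
  have hpos : ∀ x, dist (G x) (F x₀) < ε → 0 < s * (jacobian G x).det := by
    intro x hx
    have hxK : F x ∈ Metric.ball (F x₀) r := by
      have := hGF x
      have := dist_triangle_left (F x) (F x₀) (G x)
      have : ε ≤ r / 2 := min_le_left _ _
      rw [Metric.mem_ball]; linarith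
    have hev : G =ᶠ[𝓝 x] F := by
      filter_upwards [hF.continuousAt.preimage_mem_nhds (Metric.isOpen_ball.mem_nhds hxK)]
        with z hz using hGK (Metric.ball_subset_closedBall hz)
    have : jacobian G x = jacobian F x := by
      ext i j
      simp [jacobian, gradRows, hev.fderiv_eq]
    rw [this]
    exact hs x (hKU (Metric.ball_subset_closedBall hxK))
  have hcont : Continuous fun x => φ (G x) * (s * (jacobian G x).det) :=
    (φ.continuous.comp hG.continuous).mul
      (continuous_const.mul (contDiff_det_jacobian hG).continuous)
  have hint : 0 < ∫ x, φ (G x) * (s * (jacobian G x).det) := by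
    refine hcont.integral_pos_of_hasCompactSupport_nonneg_nonzero (x := x₀) ?_ (fun x => ?_) ?_
    · exact (HasCompactSupport.intro (hGprop _ φ.hasCompactSupport) fun x hx =>
        image_eq_zero_of_notMem_tsupport (f := φ) hx).mul_right
    · by_cases h : dist (G x) (F x₀) < ε
      · exact mul_nonneg φ.nonneg (hpos x h).le
      · simp [hφ0 _ (not_lt.1 h)]
    · have h : G x₀ = F x₀ := hGK (Metric.mem_closedBall_self hr.le)
      have h1 : φ (G x₀) = 1 := φ.one_of_mem_closedBall
        (by rw [h]; exact Metric.mem_closedBall_self φ.rIn_pos.le)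
      rw [h1, one_mul]
      exact (hpos x₀ (by simpa [h] using hεpos)).ne'
  have : ∫ x, φ (G x) * (s * (jacobian G x).det) = s * ∫ x, φ (G x) * (jacobian G x).det := by
    rw [← integral_const_mul]
    congr 1; ext x; ring
  rw [this, ← key, mul_zero] at hint
  exact lt_irrefl _ hint

lemma IsPolyhedron.isClosed {n : ℕ} {P : Set (Fin n → ℝ)} (hP : IsPolyhedron P) : IsClosed P := by
  obtain ⟨m, a, c, rfl⟩ := hP
  simp only [ofPred_forall]
  exact isClosed_iInter fun i => isClosed_le (by fun_prop) continuous_const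

lemma IsPolyhedron.convex {n : ℕ} {P : Set (Fin n → ℝ)} (hP : IsPolyhedron P) : Convex ℝ P := by
  obtain ⟨m, a, c, rfl⟩ := hP
  simp only [ofPred_forall]
  refine convex_iInter fun i => ?_
  exact convex_halfSpace_le (dotProductBilin ℝ ℝ (a i)).isLinear (c i)

lemma contDiff_mulVec_add {n : ℕ} (A : Matrix (Fin n) (Fin n) ℝ) (b : Fin n → ℝ) :
    ContDiff ℝ 2 fun x => A.mulVec x + b :=
  (LinearMap.toContinuousLinearMap A.mulVecLin).contDiff.add contDiff_const

lemma jacobian_mulVec_add {n : ℕ} (A : Matrix (Fin n) (Fin n) ℝ) (b x : Fin n → ℝ) :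
    jacobian (fun x => A.mulVec x + b) x = A := by
  have h : HasFDerivAt (fun x => A.mulVec x + b) (LinearMap.toContinuousLinearMap A.mulVecLin) x :=
    (LinearMap.toContinuousLinearMap A.mulVecLin).hasFDerivAt.add_const b
  ext i j
  simp [jacobian, gradRows, h.fderiv]

lemma nonsing_inv_mulVec_sub {n : ℕ} {A : Matrix (Fin n) (Fin n) ℝ} (hA : A.det ≠ 0)
    (b x : Fin n → ℝ) : A⁻¹.mulVec (A.mulVec x + b - b) = x := by
  rw [add_sub_cancel_right, Matrix.mulVec_mulVec, Matrix.nonsing_inv_mul _ hA.isUnit,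
    Matrix.one_mulVec]

lemma contDiff_mulVec_sub {n : ℕ} (A : Matrix (Fin n) (Fin n) ℝ) (b : Fin n → ℝ) :
    ContDiff ℝ 2 fun y => A.mulVec (y - b) :=
  (LinearMap.toContinuousLinearMap A.mulVecLin).contDiff.comp (contDiff_id.sub contDiff_const)

/-- A continuous map that is affine with invertible linear part on each unbounded member of a
finite cover is proper. -/
lemma isCompact_preimage_of_affine_at_infinity {n : ℕ} {F : (Fin n → ℝ) → (Fin n → ℝ)}
    {𝒞 : Set (Set (Fin n → ℝ))} (hF : Continuous F) (hfin : 𝒞.Finite) (hcover : ⋃₀ 𝒞 = univ)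
    (hinv : ∀ P ∈ 𝒞, ¬ IsBounded P → ∃ A : Matrix (Fin n) (Fin n) ℝ, ∃ b : Fin n → ℝ,
      (∀ x ∈ P, F x = A.mulVec x + b) ∧ A.det ≠ 0)
    (K : Set (Fin n → ℝ)) (hK : IsCompact K) : IsCompact (F ⁻¹' K) := by
  refine Metric.isCompact_of_isClosed_isBounded (hK.isClosed.preimage hF) ?_
  have hsub : F ⁻¹' K ⊆ ⋃ P ∈ 𝒞, P ∩ F ⁻¹' K := by
    intro x hx
    obtain ⟨P, hP, hxP⟩ := mem_sUnion.1 (hcover ▸ mem_univ x)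
    exact mem_biUnion hP ⟨hxP, hx⟩
  refine ((isBounded_biUnion hfin).2 fun P hP => ?_).subset hsub
  by_cases hb : IsBounded P
  · exact hb.subset inter_subset_left
  · obtain ⟨A, b, hA, hdet⟩ := hinv P hP hb
    refine (hK.image (contDiff_mulVec_sub A⁻¹ b).continuous).isBounded.subset ?_
    rintro x ⟨hxP, hxK⟩
    refine ⟨F x, hxK, ?_⟩
    simp only [hA x hxP]
    exact nonsing_inv_mulVec_sub hdet b x

/-- Let `F : ℝⁿ → ℝⁿ` be continuous and let `𝒞` be a finite collection
of nonempty `n`-dimensional convex polyhedra covering `ℝⁿ`, distinct members meeting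
in a common proper face or not at all. If on every unbounded polyhedron of `𝒞` the map
`F` coincides with an affine map, and the linear parts of these affine maps all have
positive determinant or all have negative determinant, then `F` is surjective.
(No affinity of `F` is required on the bounded polyhedra of `𝒞`.) -/
theorem surjective_of_affine_coherently_oriented_at_infinity
    {n : ℕ} (F : (Fin n → ℝ) → (Fin n → ℝ)) (𝒞 : Set (Set (Fin n → ℝ)))
    (hF : Continuous F)
    (hfin : 𝒞.Finite)
    (hpoly : ∀ P ∈ 𝒞, IsPolyhedron P ∧ (interior P).Nonempty)
    (hcover : ⋃₀ 𝒞 = univ)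
    (hfaces : ∀ P ∈ 𝒞, ∀ Q ∈ 𝒞, P ≠ Q →
      P ∩ Q = ∅ ∨ (IsProperFaceOf (P ∩ Q) P ∧ IsProperFaceOf (P ∩ Q) Q))
    (hco : (∀ P ∈ 𝒞, ¬ IsBounded P → ∃ A : Matrix (Fin n) (Fin n) ℝ, ∃ b : Fin n → ℝ,
              (∀ x ∈ P, F x = A.mulVec x + b) ∧ 0 < A.det) ∨
           (∀ P ∈ 𝒞, ¬ IsBounded P → ∃ A : Matrix (Fin n) (Fin n) ℝ, ∃ b : Fin n → ℝ,
              (∀ x ∈ P, F x = A.mulVec x + b) ∧ A.det < 0)) :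
    Function.Surjective F := by
  rcases Nat.eq_zero_or_pos n with rfl | hn
  · exact fun y => ⟨y, Subsingleton.elim _ _⟩
  have : Nonempty (Fin n) := ⟨⟨0, hn⟩⟩
  obtain ⟨s, hs⟩ : ∃ s : ℝ, ∀ P ∈ 𝒞, ¬ IsBounded P →
      ∃ A : Matrix (Fin n) (Fin n) ℝ, ∃ b : Fin n → ℝ,
        (∀ x ∈ P, F x = A.mulVec x + b) ∧ 0 < s * A.det := by
    rcases hco with h | h
    · exact ⟨1, by simpa only [one_mul] using h⟩
    · exact ⟨-1, by simpa only [neg_one_mul, Left.neg_pos_iff] using h⟩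
  have hne : ∀ {A : Matrix (Fin n) (Fin n) ℝ}, 0 < s * A.det → A.det ≠ 0 :=
    fun h h0 => by simp [h0] at h
  have hprop := isCompact_preimage_of_affine_at_infinity hF hfin hcover fun P hP hb =>
    let ⟨A, b, h1, h2⟩ := hs P hP hb
    ⟨A, b, h1, hne h2⟩
  set B : Set (Fin n → ℝ) := ⋃ P ∈ {P ∈ 𝒞 | IsBounded P}, P
  have hfinB : {P ∈ 𝒞 | IsBounded P}.Finite := hfin.subset (sep_subset _ _)
  have hFB : IsCompact (F '' B) := by
    refine IsCompact.image ?_ hF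
    exact hfinB.isCompact_biUnion fun P hP =>
      Metric.isCompact_of_isClosed_isBounded (hpoly P hP.1).1.isClosed hP.2
  set U : Set (Fin n → ℝ) := ⋃ P ∈ {P ∈ 𝒞 | ¬ IsBounded P}, interior P
  have hfinU : {P ∈ 𝒞 | ¬ IsBounded P}.Finite := hfin.subset (sep_subset _ _)
  set N : Set (Fin n → ℝ) := ⋃ P ∈ {P ∈ 𝒞 | ¬ IsBounded P}, F '' frontier P
  have hN0 : volume N = 0 := by
    refine (measure_biUnion_null_iff hfinU.countable).2 fun P hP => ?_
    obtain ⟨A, b, hA, -⟩ := hs P hP.1 hP.2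
    have hPp := (hpoly P hP.1).1
    have him : F '' frontier P = (fun x => A.mulVec x + b) '' frontier P :=
      image_congr fun x hx => hA x (hPp.isClosed.frontier_subset hx)
    rw [him]
    exact addHaar_image_eq_zero_of_differentiableOn_of_addHaar_eq_zero volume
      ((contDiff_mulVec_add A b).differentiable (by norm_num)).differentiableOn
      (hPp.convex.addHaar_frontier volume)
  have hgerm : ∀ x ∈ U, ∃ A : Matrix (Fin n) (Fin n) ℝ, ∃ b : Fin n → ℝ,
      F =ᶠ[𝓝 x] (fun x => A.mulVec x + b) ∧ 0 < s * A.det := by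
    intro x hx
    obtain ⟨P, hP, hxP⟩ := mem_iUnion₂.1 hx
    obtain ⟨A, b, hA, hdet⟩ := hs P hP.1 hP.2
    refine ⟨A, b, ?_, hdet⟩
    filter_upwards [isOpen_interior.mem_nhds hxP] with z hz using hA z (interior_subset hz)
  obtain ⟨P₀, hP₀, hP₀b⟩ : ∃ P ∈ 𝒞, ¬ IsBounded P := by
    by_contra! h
    refine NormedSpace.unbounded_univ ℝ (Fin n → ℝ) ?_
    rw [← hcover]
    exact (isBounded_sUnion hfin).2 h
  obtain ⟨A, b, hA, hdet⟩ := hs P₀ hP₀ hP₀b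
  set W : Set (Fin n → ℝ) := interior P₀ ∩ F ⁻¹' (F '' B)ᶜ with hW
  have hWo : IsOpen W := isOpen_interior.inter (hFB.isClosed.isOpen_compl.preimage hF)
  have hWne : W.Nonempty := by
    obtain ⟨x, hx, hxB⟩ : ∃ x ∈ P₀, x ∉ F ⁻¹' (F '' B) := by
      by_contra! h
      exact hP₀b ((hprop _ hFB).isBounded.subset h)
    have hcl : x ∈ closure (interior P₀) := by
      rw [(hpoly P₀ hP₀).1.convex.closure_interior_eq_closure_of_nonempty_interior
        (hpoly P₀ hP₀).2]
      exact subset_closure hx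
    rw [hW, inter_comm]
    exact mem_closure_iff.1 hcl _ (hFB.isClosed.isOpen_compl.preimage hF) hxB
  obtain ⟨x₀, hx₀, hx₀N⟩ : ∃ x ∈ W, F x ∉ N := by
    by_contra! h
    have hsub : W ⊆ (fun y => A⁻¹.mulVec (y - b)) '' N := by
      intro x hx
      refine ⟨F x, h x hx, ?_⟩
      simp only [hA x (interior_subset hx.1)]
      exact nonsing_inv_mulVec_sub (hne hdet) b x
    have h0 : volume ((fun y => A⁻¹.mulVec (y - b)) '' N) = 0 :=
      addHaar_image_eq_zero_of_differentiableOn_of_addHaar_eq_zero volume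
        ((contDiff_mulVec_sub A⁻¹ b).differentiable (by norm_num)).differentiableOn hN0
    exact (hWo.measure_pos volume hWne).ne' (measure_mono_null hsub h0)
  refine surjective_of_det_jacobian_pos hF hprop
    (isOpen_biUnion fun P _ => isOpen_interior : IsOpen U) (fun x hx => ?_) s (fun x hx => ?_) x₀
    fun x hx => ?_
  · obtain ⟨A, b, h, -⟩ := hgerm x hx
    exact ((contDiff_mulVec_add A b).contDiffAt.congr_of_eventuallyEq h).contDiffWithinAt
  · obtain ⟨A, b, h, hd⟩ := hgerm x hx
    have : jacobian F x = A := by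
      rw [← jacobian_mulVec_add A b x]
      ext i j
      simp [jacobian, gradRows, h.fderiv_eq]
    rwa [this]
  · have hx : F x = F x₀ := hx
    obtain ⟨P, hP, hxP⟩ := mem_sUnion.1 (hcover ▸ mem_univ x)
    by_cases hb : IsBounded P
    · exact absurd ⟨x, mem_biUnion (⟨hP, hb⟩ : P ∈ {P ∈ 𝒞 | IsBounded P}) hxP, hx⟩ hx₀.2
    · have hPm : P ∈ {P ∈ 𝒞 | ¬ IsBounded P} := ⟨hP, hb⟩
      by_cases hi : x ∈ interior P
      · exact mem_biUnion hPm hi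
      · have hf : F x₀ ∈ F '' frontier P := ⟨x, ⟨subset_closure hxP, hi⟩, hx⟩
        exact absurd (mem_biUnion hPm hf) hx₀N
end
end

section
/- Let F : ℝ^n → ℝ^n be a coherently oriented piecewise affine function. Then F is an open map. -/
open Set Filter Bornology

noncomputable section

section CoherentOrientation

variable {n : ℕ}

theorem affMap_sub (p : Matrix (Fin n) (Fin n) ℝ × (Fin n → ℝ)) (x y : Fin n → ℝ) :
    affMap p y - affMap p x = p.1.mulVec (y - x) := by
  simp [affMap, Matrix.mulVec_sub]

theorem affMap_add (p : Matrix (Fin n) (Fin n) ℝ × (Fin n → ℝ)) (x h : Fin n → ℝ) :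
    affMap p (x + h) = affMap p x + p.1.mulVec h := by
  simp [affMap, Matrix.mulVec_add]; abel

theorem continuous_affMap (p : Matrix (Fin n) (Fin n) ℝ × (Fin n → ℝ)) :
    Continuous (affMap p) :=
  (p.1.mulVecLin.continuous_of_finiteDimensional).add continuous_const

/-- If two matrices whose determinants have the same sign agree on the kernel of a linear
functional, then they map the same side of the kernel to the same side of its image. -/
theorem neg_of_mulVec_eq {A B : Matrix (Fin n) (Fin n) ℝ} {l : (Fin n → ℝ) →ₗ[ℝ] ℝ}
    (hker : ∀ h, l h = 0 → A.mulVec h = B.mulVec h) (hdet : 0 < A.det * B.det)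
    {a b : Fin n → ℝ} (hab : A.mulVec a = B.mulVec b) (ha : l a < 0) : l b < 0 := by
  have hA : A.det ≠ 0 := by rintro h; simp [h] at hdet
  have hAu : IsUnit A.det := hA.isUnit
  set e : Fin n → ℝ := (l a)⁻¹ • a with he
  have hle : l e = 1 := by simp [he, ha.ne]
  set v : Fin n → ℝ := (A⁻¹ * B).mulVec e - e with hv
  have hC : ∀ h, (A⁻¹ * B).mulVec h = h + l h • v := by
    intro h
    have h1 := hker (h - l h • e) (by simp [hle])
    have h2 : (A⁻¹ * B).mulVec (h - l h • e) = h - l h • e := by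
      rw [← Matrix.mulVec_mulVec, ← h1, Matrix.mulVec_mulVec, Matrix.nonsing_inv_mul _ hAu,
        Matrix.one_mulVec]
    rw [Matrix.mulVec_sub, Matrix.mulVec_smul] at h2
    rw [hv, smul_sub]
    linear_combination h2
  have hT : Matrix.toLin' (A⁻¹ * B) = LinearMap.transvection l v := by
    refine LinearMap.ext fun h => ?_
    rw [Matrix.toLin'_apply, hC, LinearMap.transvection.apply]
  have hdet' : (A⁻¹ * B).det = 1 + l v := by
    rw [← LinearMap.det_toLin', hT, LinearMap.transvection.det]
  have hpos : 0 < 1 + l v := by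
    rw [← hdet', Matrix.det_mul, Matrix.det_nonsing_inv, Ring.inverse_eq_inv']
    have : A.det⁻¹ * B.det = (A.det * B.det) / A.det ^ 2 := by field_simp
    rw [this]
    positivity
  have h3 : a = b + l b • v := by
    rw [← hC, ← Matrix.mulVec_mulVec, ← hab, Matrix.mulVec_mulVec,
      Matrix.nonsing_inv_mul _ hAu, Matrix.one_mulVec]
  have h4 : l a = l b * (1 + l v) := by
    conv_lhs => rw [h3]
    simp; ring
  by_contra! hb
  nlinarith [mul_nonneg hb hpos.le]

/-- On a convex set where the graphs of distinct selection functions do not meet, a single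
selection function is active. -/
theorem exists_activeOn_of_convex {F : (Fin n → ℝ) → (Fin n → ℝ)}
    {S : Finset (Matrix (Fin n) (Fin n) ℝ × (Fin n → ℝ))} (hF : IsPWA F S)
    {U : Set (Fin n → ℝ)} (hU : Convex ℝ U)
    (hS : ∀ p ∈ S, ∀ q ∈ S, ∀ y ∈ U, affMap p y = affMap q y → p = q) :
    ∃ p ∈ S, ActiveOn F p U := by
  obtain rfl | ⟨y, hy⟩ := U.eq_empty_or_nonempty
  · obtain ⟨p, hp, -⟩ := hF.2 0
    exact ⟨p, hp, by simp [ActiveOn]⟩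
  obtain ⟨p, hp, hpy⟩ := hF.2 y
  refine ⟨p, hp, ?_⟩
  have hcl : ∀ q, IsClosed {z | F z = affMap q z} := fun q =>
    isClosed_eq hF.1 (continuous_affMap q)
  have key := isPreconnected_closed_iff.1 hU.isPreconnected {z | F z = affMap p z}
    (⋃ q ∈ (S : Set _) \ {p}, {z | F z = affMap q z}) (hcl p)
    ((S.finite_toSet.subset sdiff_subset).isClosed_biUnion fun q _ => hcl q)
    (by
      intro z _
      obtain ⟨q, hq, hqz⟩ := hF.2 z
      by_cases h : q = p
      · exact Or.inl (h ▸ hqz)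
      · exact Or.inr (mem_biUnion (show q ∈ (S : Set _) \ {p} from ⟨hq, h⟩) hqz))
    ⟨y, hy, hpy⟩
  intro z hz
  by_contra hzp
  obtain ⟨q, hq, hqz⟩ := hF.2 z
  obtain ⟨w, hw, hw1, hw2⟩ := key ⟨z, hz, mem_biUnion
    (show q ∈ (S : Set _) \ {p} from ⟨hq, fun h => hzp (h ▸ hqz)⟩) hqz⟩
  simp only [mem_iUnion] at hw2
  obtain ⟨r, hr, hwr⟩ := hw2
  exact hr.2 (hS p hp r hr.1 w hw (hw1.symm.trans hwr)).symm

/-- If the selection functions which agree at `x` also agree on a hyperplane through `x`, then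
near `x` and on one side of the hyperplane a single selection function is active. -/
theorem exists_activeOn_side {F : (Fin n → ℝ) → (Fin n → ℝ)}
    {S : Finset (Matrix (Fin n) (Fin n) ℝ × (Fin n → ℝ))} (hF : IsPWA F S)
    {x : Fin n → ℝ} {ε : ℝ}
    (hε : ∀ p ∈ S, ∀ q ∈ S, ∀ y ∈ Metric.ball x ε,
      affMap p y = affMap q y → affMap p x = affMap q x)
    {l : (Fin n → ℝ) →ₗ[ℝ] ℝ} (hl : l ≠ 0)
    (hker : ∀ p ∈ S, ∀ q ∈ S, affMap p x = affMap q x →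
      ∀ h, l h = 0 → p.1.mulVec h = q.1.mulVec h) :
    ∃ p ∈ S, ActiveOn F p {y ∈ Metric.ball x ε | 0 ≤ l (y - x)} := by
  have hconv : Convex ℝ {y ∈ Metric.ball x ε | 0 < l (y - x)} := by
    have : {y ∈ Metric.ball x ε | 0 < l (y - x)} = Metric.ball x ε ∩ {y | l x < l y} := by
      ext y; simp
    rw [this]
    exact (convex_ball x ε).inter (convex_halfSpace_gt l.isLinear _)
  obtain ⟨p, hp, hpU⟩ := exists_activeOn_of_convex hF hconv (by
    rintro p hp q hq y ⟨hy, hly⟩ hpq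
    have hx := hε p hp q hq y hy hpq
    have h1 := hker p hp q hq hx
    have h2 : p.1.mulVec (y - x) = q.1.mulVec (y - x) := by
      rw [← affMap_sub, ← affMap_sub, hpq, hx]
    have h3 : p.1 = q.1 := by
      refine Matrix.toLin'.injective (LinearMap.ext fun h => ?_)
      simp only [Matrix.toLin'_apply]
      have h4 := h1 (h - (l h / l (y - x)) • (y - x)) (by
        rw [map_sub, map_smul, smul_eq_mul, div_mul_cancel₀ _ hly.ne', sub_self])
      simpa only [Matrix.mulVec_sub, Matrix.mulVec_smul, h2, sub_left_inj] using h4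
    refine Prod.ext h3 ?_
    simpa [affMap, h3] using hx)
  refine ⟨p, hp, ?_⟩
  rintro y ⟨hy, hly⟩
  obtain ⟨e, he⟩ : ∃ e, 0 < l e := by
    obtain ⟨e, he⟩ := DFunLike.ne_iff.1 hl
    rcases lt_or_gt_of_ne he with h | h
    · exact ⟨-e, by simpa using h⟩
    · exact ⟨e, by simpa using h⟩
  have hcont : Continuous fun s : ℝ => y + s • e := by fun_prop
  have ht : Tendsto (fun s : ℝ => y + s • e) (nhdsWithin 0 (Ioi 0)) (nhds y) := by
    simpa using (hcont.tendsto 0).mono_left nhdsWithin_le_nhds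
  refine tendsto_nhds_unique_of_eventuallyEq ((hF.1.tendsto y).comp ht)
    (((continuous_affMap p).tendsto y).comp ht) ?_
  filter_upwards [ht (Metric.isOpen_ball.mem_nhds hy), self_mem_nhdsWithin] with s hs hs0
  refine hpU _ ⟨hs, ?_⟩
  have : l (y + s • e - x) = l (y - x) + s * l e := by simp; ring
  rw [this]
  have := mul_pos (mem_Ioi.1 hs0) he
  linarith

open Classical in
/-- The pairs of selection functions which agree at `x`. -/
def coincidences (S : Finset (Matrix (Fin n) (Fin n) ℝ × (Fin n → ℝ))) (x : Fin n → ℝ) :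
    Finset ((Matrix (Fin n) (Fin n) ℝ × (Fin n → ℝ)) ×
      (Matrix (Fin n) (Fin n) ℝ × (Fin n → ℝ))) :=
  {r ∈ S ×ˢ S | affMap r.1 x = affMap r.2 x}

/-- The directions along which the linear parts of all pairs in `T` agree. -/
def agreement (T : Finset ((Matrix (Fin n) (Fin n) ℝ × (Fin n → ℝ)) ×
      (Matrix (Fin n) (Fin n) ℝ × (Fin n → ℝ)))) : Submodule ℝ (Fin n → ℝ) :=
  ⨅ r ∈ T, LinearMap.ker (r.1.1.mulVecLin - r.2.1.mulVecLin)

theorem mem_agreement_coincidences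
    {S : Finset (Matrix (Fin n) (Fin n) ℝ × (Fin n → ℝ))} {x h : Fin n → ℝ} :
    h ∈ agreement (coincidences S x) ↔ ∀ p ∈ S, ∀ q ∈ S, affMap p x = affMap q x →
      p.1.mulVec h = q.1.mulVec h := by
  simp only [agreement, coincidences, Submodule.mem_iInf, Finset.mem_filter, Finset.mem_product,
    LinearMap.mem_ker, LinearMap.sub_apply, Matrix.mulVecLin_apply, sub_eq_zero]
  exact ⟨fun H p hp q hq hpq => H (p, q) ⟨⟨hp, hq⟩, hpq⟩,
    fun H r hr => H r.1 hr.1.1 r.2 hr.1.2 hr.2⟩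

theorem exists_ker_le_of_finrank (hn : n ≠ 0) {V : Submodule ℝ (Fin n → ℝ)}
    (hV : n < Module.finrank ℝ V + 2) :
    ∃ l : (Fin n → ℝ) →ₗ[ℝ] ℝ, l ≠ 0 ∧ LinearMap.ker l ≤ V := by
  have : NeZero n := ⟨hn⟩
  by_cases hVt : V = ⊤
  · exact ⟨LinearMap.proj 0, fun h => by simpa using LinearMap.congr_fun h (Pi.single 0 1),
      hVt ▸ le_top⟩
  obtain ⟨l, hl, hVl⟩ := Submodule.exists_le_ker_of_lt_top V (lt_top_iff_ne_top.2 hVt)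
  refine ⟨l, hl, (Submodule.eq_of_le_of_finrank_le hVl ?_).ge⟩
  have h : Module.finrank ℝ (LinearMap.ker l) < n := by
    simpa using Submodule.finrank_lt (s := LinearMap.ker l) (by rwa [Ne, LinearMap.ker_eq_top])
  omega

/-- A coherently oriented piecewise affine function is open at every point where the agreement
space of the active selection functions has codimension at most one. -/
theorem nhds_le_map_of_finrank {F : (Fin n → ℝ) → (Fin n → ℝ)}
    {S : Finset (Matrix (Fin n) (Fin n) ℝ × (Fin n → ℝ))} (hF : IsPWA F S)
    (hdet : ∀ p ∈ S, ∀ q ∈ S, 0 < p.1.det * q.1.det) {x : Fin n → ℝ}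
    (hx : n < Module.finrank ℝ (agreement (coincidences S x)) + 2) :
    nhds (F x) ≤ map F (nhds x) := by
  rcases eq_or_ne n 0 with rfl | hn
  · intro U hU
    have h : F x ∈ U := mem_of_mem_nhds (x := x) hU
    rw [Subsingleton.eq_univ_of_nonempty ⟨_, h⟩]
    exact univ_mem
  obtain ⟨l, hl, hlV⟩ := exists_ker_le_of_finrank hn hx
  have hker : ∀ p ∈ S, ∀ q ∈ S, affMap p x = affMap q x →
      ∀ h, l h = 0 → p.1.mulVec h = q.1.mulVec h := fun p hp q hq hpq h hh =>
    mem_agreement_coincidences.1 (hlV hh) p hp q hq hpq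
  obtain ⟨ε, hε, hball⟩ : ∃ ε > 0, ∀ p ∈ S, ∀ q ∈ S, ∀ y ∈ Metric.ball x ε,
      affMap p y = affMap q y → affMap p x = affMap q x := by
    have : ∀ᶠ y in nhds x, ∀ p ∈ S, ∀ q ∈ S, affMap p y = affMap q y →
        affMap p x = affMap q x := by
      rw [Filter.eventually_all_finset]
      intro p _
      rw [Filter.eventually_all_finset]
      intro q _
      by_cases h : affMap p x = affMap q x
      · simp [h]
      · filter_upwards [(isClosed_eq (continuous_affMap p) (continuous_affMap q)).isOpen_compl.mem_nhds
          h] with y hy hy'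
        exact absurd hy' hy
    obtain ⟨ε, hε, h⟩ := Metric.eventually_nhds_iff_ball.1 this
    exact ⟨ε, hε, fun p hp q hq y hy => h y hy p hp q hq⟩
  obtain ⟨p, hp, hpF⟩ := exists_activeOn_side hF hball hl hker
  obtain ⟨q, hq, hqF⟩ := exists_activeOn_side hF hball (neg_ne_zero.2 hl)
    (fun p hp q hq hpq h hh => hker p hp q hq hpq h (by simpa using hh))
  have hpx : F x = affMap p x := hpF x ⟨Metric.mem_ball_self hε, by simp⟩
  have hqx : F x = affMap q x := hqF x ⟨Metric.mem_ball_self hε, by simp⟩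
  have hunit : ∀ r ∈ S, IsUnit r.1.det := fun r hr => by
    have := hdet r hr r hr
    exact (left_ne_zero_of_mul this.ne').isUnit
  have htend : ∀ r : Matrix (Fin n) (Fin n) ℝ × (Fin n → ℝ),
      Tendsto (fun y => x + r.1⁻¹.mulVec (y - F x)) (nhds (F x)) (nhds x) := fun r => by
    have hc : Continuous fun y => x + r.1⁻¹.mulVec (y - F x) :=
      continuous_const.add
        ((r.1⁻¹.mulVecLin.continuous_of_finiteDimensional).comp (continuous_id.sub continuous_const))
    simpa using hc.tendsto (F x)
  have hinv : ∀ r ∈ S, ∀ d, r.1.mulVec (r.1⁻¹.mulVec d) = d := fun r hr d => by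
    rw [Matrix.mulVec_mulVec, Matrix.mul_nonsing_inv _ (hunit r hr), Matrix.one_mulVec]
  intro U hU
  have hN : F ⁻¹' U ∩ Metric.ball x ε ∈ nhds x := inter_mem hU (Metric.ball_mem_nhds x hε)
  filter_upwards [htend p hN, htend q hN] with y hy1 hy2
  by_cases ha : 0 ≤ l (p.1⁻¹.mulVec (y - F x))
  · have h := hpF _ ⟨hy1.2, by simpa using ha⟩
    rw [affMap_add, hinv p hp, ← hpx, add_sub_cancel] at h
    have := hy1.1
    rwa [mem_preimage, h] at this
  · have hb : l (q.1⁻¹.mulVec (y - F x)) < 0 :=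
      neg_of_mulVec_eq (hker p hp q hq (hpx.symm.trans hqx)) (hdet p hp q hq)
        ((hinv p hp _).trans (hinv q hq _).symm) (not_le.1 ha)
    have h := hqF _ ⟨hy2.2, by simpa using hb.le⟩
    rw [affMap_add, hinv q hq, ← hqx, add_sub_cancel] at h
    have := hy2.1
    rwa [mem_preimage, h] at this

/-- A nonempty open set is not covered by finitely many translates of proper subspaces. -/
theorem exists_mem_open_forall_sub_notMem {ι : Type*} {U : Set (Fin n → ℝ)} (hU : IsOpen U)
    (hne : U.Nonempty) {s : Set ι} (hs : s.Finite) (W : ι → Submodule ℝ (Fin n → ℝ))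
    (c : ι → Fin n → ℝ) (hW : ∀ i ∈ s, W i ≠ ⊤) : ∃ y ∈ U, ∀ i ∈ s, y - c i ∉ W i := by
  by_contra! h
  have h0 : MeasureTheory.volume (⋃ i ∈ s, (fun y => y - c i) ⁻¹' (W i : Set (Fin n → ℝ))) = 0 := by
    rw [MeasureTheory.measure_biUnion_null_iff hs.countable]
    intro i hi
    simp only [sub_eq_add_neg]
    rw [MeasureTheory.measure_preimage_add_right]
    exact MeasureTheory.Measure.addHaar_submodule _ _ (hW i hi)
  refine (hU.measure_pos MeasureTheory.volume hne).ne' (MeasureTheory.measure_mono_null ?_ h0)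
  intro y hy
  obtain ⟨i, hi, hyi⟩ := h y hy
  exact mem_biUnion hi hyi

/-- The sets of pairs of selection functions whose agreement space has codimension at least
two. -/
def thinPatterns (S : Finset (Matrix (Fin n) (Fin n) ℝ × (Fin n → ℝ))) :
    Set (Finset ((Matrix (Fin n) (Fin n) ℝ × (Fin n → ℝ)) ×
      (Matrix (Fin n) (Fin n) ℝ × (Fin n → ℝ)))) :=
  {T | T ⊆ S ×ˢ S ∧ Module.finrank ℝ (agreement T) + 2 ≤ n}

theorem finite_thinPatterns (S : Finset (Matrix (Fin n) (Fin n) ℝ × (Fin n → ℝ))) :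
    (thinPatterns S).Finite :=
  (S ×ˢ S).powerset.finite_toSet.subset fun _ hT => Finset.mem_coe.2 (Finset.mem_powerset.2 hT.1)

theorem coincidences_mem_thinPatterns
    {S : Finset (Matrix (Fin n) (Fin n) ℝ × (Fin n → ℝ))} {x : Fin n → ℝ}
    (hx : ¬ n < Module.finrank ℝ (agreement (coincidences S x)) + 2) :
    coincidences S x ∈ thinPatterns S := by
  classical
  exact ⟨Finset.filter_subset _ _, not_lt.1 hx⟩

/-- A point with a prescribed set of coinciding pairs of selection functions, if there is one. -/
def patternPoint (S : Finset (Matrix (Fin n) (Fin n) ℝ × (Fin n → ℝ))) :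
    Finset ((Matrix (Fin n) (Fin n) ℝ × (Fin n → ℝ)) ×
      (Matrix (Fin n) (Fin n) ℝ × (Fin n → ℝ))) → Fin n → ℝ :=
  Function.invFun (coincidences S)

theorem sub_patternPoint_mem_agreement
    (S : Finset (Matrix (Fin n) (Fin n) ℝ × (Fin n → ℝ))) (x : Fin n → ℝ) :
    x - patternPoint S (coincidences S x) ∈ agreement (coincidences S x) := by
  set c := patternPoint S (coincidences S x) with hc
  have hcx : coincidences S c = coincidences S x := Function.invFun_eq ⟨x, rfl⟩
  refine mem_agreement_coincidences.2 fun p hp q hq hpq => ?_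
  have hcpq : affMap p c = affMap q c := by
    classical
    have : (p, q) ∈ coincidences S c := by
      rw [hcx]
      exact Finset.mem_filter.2 ⟨Finset.mem_product.2 ⟨hp, hq⟩, hpq⟩
    exact (Finset.mem_filter.1 this).2
  rw [← affMap_sub, ← affMap_sub, hpq, hcpq]

theorem finite_fiber {F : (Fin n → ℝ) → (Fin n → ℝ)}
    {S : Finset (Matrix (Fin n) (Fin n) ℝ × (Fin n → ℝ))} (hF : IsPWA F S)
    (hdet : ∀ p ∈ S, p.1.det ≠ 0) (y : Fin n → ℝ) : (F ⁻¹' {y}).Finite := by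
  have : F ⁻¹' {y} ⊆ ⋃ p ∈ (S : Set _), {x | affMap p x = y} := by
    intro x hx
    obtain ⟨p, hp, hpx⟩ := hF.2 x
    exact mem_biUnion (Finset.mem_coe.2 hp) (hpx.symm.trans hx)
  refine (S.finite_toSet.biUnion fun p hp => Set.Subsingleton.finite ?_).subset this
  intro a ha b hb
  refine Matrix.mulVec_injective_of_det_ne_zero (hdet p hp) ?_
  have hab : affMap p a = affMap p b := Eq.trans ha (Eq.symm hb)
  simpa [affMap] using hab

theorem span_sup_map_ne_top {V : Submodule ℝ (Fin n → ℝ)}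
    (hV : Module.finrank ℝ V + 2 ≤ n) (v : Fin n → ℝ) (f : (Fin n → ℝ) →ₗ[ℝ] (Fin n → ℝ)) :
    Submodule.span ℝ {v} ⊔ V.map f ≠ ⊤ := by
  intro h
  have h1 := Submodule.finrank_add_le_finrank_add_finrank (Submodule.span ℝ {v}) (V.map f)
  have h2 : Module.finrank ℝ (Submodule.span ℝ {v}) ≤ 1 := by
    simpa using finrank_span_le_card (R := ℝ) ({v} : Set (Fin n → ℝ))
  have h3 := Submodule.finrank_map_le f V
  rw [h, finrank_top, Module.finrank_fin_fun] at h1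
  omega

/-- The image of a closed ball under a coherently oriented piecewise affine function contains
every ball around the image of the centre that misses the image of the sphere. -/
theorem ball_subset_image_closedBall {F : (Fin n → ℝ) → (Fin n → ℝ)}
    {S : Finset (Matrix (Fin n) (Fin n) ℝ × (Fin n → ℝ))} (hF : IsPWA F S)
    (hdet : ∀ p ∈ S, ∀ q ∈ S, 0 < p.1.det * q.1.det) {x₀ : Fin n → ℝ} {r ε : ℝ}
    (hr : 0 < r) (hε : 0 < ε) (hsph : ∀ x ∈ Metric.sphere x₀ r, F x ∉ Metric.ball (F x₀) ε) :
    Metric.ball (F x₀) ε ⊆ F '' Metric.closedBall x₀ r := by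
  set K := F '' Metric.closedBall x₀ r
  have hKc : IsClosed K := ((isCompact_closedBall x₀ r).image hF.1).isClosed
  by_contra hsub
  obtain ⟨z, hz, hzK⟩ := not_subset.1 hsub
  have hnhds : ∀ x ∈ Metric.ball x₀ r, coincidences S x ∉ thinPatterns S →
      K ∈ nhds (F x) := by
    intro x hx hthin
    refine nhds_le_map_of_finrank hF hdet
      (not_imp_comm.1 coincidences_mem_thinPatterns hthin) ?_
    refine mem_map.2 ?_
    filter_upwards [Metric.isOpen_ball.mem_nhds hx] with y hy
    exact mem_image_of_mem F (Metric.ball_subset_closedBall hy)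
  obtain ⟨x₁, ⟨hx₁, hFx₁⟩, hx₁thin⟩ := exists_mem_open_forall_sub_notMem
    (Metric.isOpen_ball.inter (Metric.isOpen_ball.preimage hF.1))
    ⟨x₀, Metric.mem_ball_self hr, Metric.mem_ball_self hε⟩ (finite_thinPatterns S)
    agreement (patternPoint S) (by
      rintro T ⟨-, hT⟩ h
      rw [h, finrank_top, Module.finrank_fin_fun] at hT
      omega)
  obtain ⟨y₂, ⟨hy₂, hy₂K⟩, hgen⟩ := exists_mem_open_forall_sub_notMem
    (Metric.isOpen_ball.inter hKc.isOpen_compl) ⟨z, hz, hzK⟩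
    ((finite_thinPatterns S).prod S.finite_toSet)
    (fun i => Submodule.span ℝ {affMap i.2 (patternPoint S i.1) - F x₁} ⊔
      (agreement i.1).map i.2.1.mulVecLin)
    (fun _ => F x₁) (fun i hi => span_sup_map_ne_top hi.1.2 _ _)
  set γ : ℝ → Fin n → ℝ := fun t => F x₁ + t • (y₂ - F x₁) with hγ
  have hγc : Continuous γ := by fun_prop
  have hIcc : Icc (0 : ℝ) 1 ⊆ γ ⁻¹' K := by
    refine IsClosed.Icc_subset_of_forall_exists_gt
      ((hKc.preimage hγc).inter isClosed_Icc) ?_ ?_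
    · simpa only [hγ, mem_preimage, zero_smul, add_zero] using mem_image_of_mem F (Metric.ball_subset_closedBall hx₁)
    rintro t ⟨htK, ht0, ht1⟩ u hu
    have hnt : K ∈ nhds (γ t) := by
      rcases ht0.eq_or_lt with rfl | ht0
      · simpa [hγ] using hnhds x₁ hx₁ fun h =>
          hx₁thin _ h (sub_patternPoint_mem_agreement S x₁)
      obtain ⟨x, hx, hxt⟩ := htK
      have hball : F x ∈ Metric.ball (F x₀) ε := by
        rw [hxt]
        exact (convex_ball (F x₀) ε).add_smul_sub_mem hFx₁ hy₂ ⟨ht0.le, ht1.le⟩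
      have hxb : x ∈ Metric.ball x₀ r := by
        rcases (Metric.mem_closedBall.1 hx).lt_or_eq with h | h
        · exact h
        · exact absurd hball (hsph x h)
      rw [← hxt]
      refine hnhds x hxb fun hthin => ?_
      obtain ⟨p, hp, hpx⟩ := hF.2 x
      refine hgen (coincidences S x, p) ⟨hthin, hp⟩ ?_
      set c := patternPoint S (coincidences S x)
      have h1 : t • (y₂ - F x₁) = (affMap p c - F x₁) + p.1.mulVecLin (x - c) := by
        rw [Matrix.mulVecLin_apply, ← affMap_sub, ← hpx, hxt]
        simp only [hγ]
        module
      refine (Submodule.smul_mem_iff _ ht0.ne').1 ?_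
      rw [h1]
      exact Submodule.add_mem_sup (Submodule.mem_span_singleton_self _)
        (Submodule.mem_map_of_mem (sub_patternPoint_mem_agreement S x))
    have h1 : ∀ᶠ s in nhdsWithin t (Ioi t), γ s ∈ K :=
      nhdsWithin_le_nhds (hγc.tendsto t hnt)
    exact (h1.and (Ioc_mem_nhdsGT hu)).exists
  have := hIcc (right_mem_Icc.2 zero_le_one)
  simp only [hγ, mem_preimage, one_smul, add_sub_cancel] at this
  exact hy₂K this

end CoherentOrientation

/-- A coherently oriented piecewise affine function `F : ℝⁿ → ℝⁿ` is an
open map. -/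
theorem isOpenMap_of_coherently_oriented
    {n : ℕ} (F : (Fin n → ℝ) → (Fin n → ℝ))
    (S : Finset (Matrix (Fin n) (Fin n) ℝ × (Fin n → ℝ)))
    (hF : IsPWA F S)
    (hco : (∀ p ∈ S, 0 < p.1.det) ∨ (∀ p ∈ S, p.1.det < 0)) :
    IsOpenMap F := by
  have hdet : ∀ p ∈ S, ∀ q ∈ S, 0 < p.1.det * q.1.det := by
    rcases hco with h | h
    · exact fun p hp q hq => mul_pos (h p hp) (h q hq)
    · exact fun p hp q hq => mul_pos_of_neg_of_neg (h p hp) (h q hq)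
  rw [isOpenMap_iff_nhds_le]
  intro x₀ U hU
  have hfin := finite_fiber hF (fun p hp => left_ne_zero_of_mul (hdet p hp p hp).ne') (F x₀)
  have hiso : (F ⁻¹' {F x₀} \ {x₀})ᶜ ∈ nhds x₀ :=
    (hfin.subset sdiff_subset).isClosed.isOpen_compl.mem_nhds fun h => h.2 rfl
  obtain ⟨r, hr, hrU⟩ := Metric.nhds_basis_closedBall.mem_iff.1 (inter_mem hU hiso)
  have hsphere : IsClosed (F '' Metric.sphere x₀ r) :=
    ((isCompact_sphere x₀ r).image hF.1).isClosed
  have hmem : F x₀ ∉ F '' Metric.sphere x₀ r := by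
    rintro ⟨x, hx, hxF⟩
    refine (hrU (Metric.sphere_subset_closedBall hx)).2 ⟨hxF, ?_⟩
    rintro rfl
    exact hr.ne (by simpa using hx)
  obtain ⟨ε, hε, hεs⟩ := Metric.isOpen_iff.1 hsphere.isOpen_compl _ hmem
  refine mem_of_superset (Metric.ball_mem_nhds _ hε) ((ball_subset_image_closedBall hF hdet hr hε
    fun x hx h => hεs h (mem_image_of_mem F hx)).trans ?_)
  rintro _ ⟨x, hx, rfl⟩
  exact (hrU hx).1
end
end

section
/- Let F : ℝ^n → ℝ^n be an injective piecewise affine function. Then there is a sign ε ∈ {+1, −1} such that for every regular value y of F, the preimage F⁻¹(y) consists of exactly one point x, and sign(det D_xF) = ε. Consequently all regular values of F lie in the image of F. -/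
open Set Filter Bornology

noncomputable section

section PiecewiseAffine

open scoped Topology

variable {V : Type*} [NormedAddCommGroup V] [NormedSpace ℝ V]

/-- A set is thin if its affine span has codimension at least two: adding any one point to it
does not make it span the space. -/
def IsThin (T : Set V) : Prop := ∀ y : V, affineSpan ℝ (insert y T) ≠ ⊤

/-- The set of points at which all maps of a family `P` agree. -/
def agreeSet (P : Set (V →ᵃ[ℝ] V)) : Set V := {x | ∀ f ∈ P, ∀ g ∈ P, f x = g x}

theorem AffineMap.apply_eq_add_linear_sub (f : V →ᵃ[ℝ] V) (x y : V) :
    f y = f x + f.linear (y - x) := by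
  have := f.map_vadd x (y - x)
  simp only [vadd_eq_add, sub_add_cancel] at this
  rw [this, add_comm]

theorem dense_biInter_compl_affineSubspace [FiniteDimensional ℝ V]
    {𝒜 : Set (AffineSubspace ℝ V)} (hfin : 𝒜.Finite) (h𝒜 : ∀ A ∈ 𝒜, A ≠ ⊤) :
    Dense {z : V | ∀ A ∈ 𝒜, z ∉ A} := by
  let _ : MeasurableSpace V := borel V
  have : BorelSpace V := ⟨rfl⟩
  refine MeasureTheory.Measure.dense_of_ae (μ := MeasureTheory.Measure.addHaar) ?_
  rw [MeasureTheory.ae_ball_iff hfin.countable]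
  intro A hA
  have := MeasureTheory.Measure.addHaar_affineSubspace
    (MeasureTheory.Measure.addHaar (G := V)) A (h𝒜 A hA)
  exact MeasureTheory.measure_eq_zero_iff_ae_notMem.1 this

theorem IsThin.dense_compl_sUnion [FiniteDimensional ℝ V] {𝒯 : Set (Set V)} (hfin : 𝒯.Finite)
    (h𝒯 : ∀ T ∈ 𝒯, IsThin T) : Dense (⋃₀ 𝒯)ᶜ := by
  refine (dense_biInter_compl_affineSubspace (hfin.image fun T => affineSpan ℝ (insert 0 T))
    ?_).mono ?_
  · rintro _ ⟨T, hT, rfl⟩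
    exact h𝒯 T hT 0
  · rintro z hz ⟨T, hT, hzT⟩
    exact hz _ ⟨T, hT, rfl⟩ (subset_affineSpan ℝ _ (mem_insert_of_mem _ hzT))

theorem disjoint_segment_of_notMem_affineSpan {T : Set V} {y z : V} (hy : y ∉ T)
    (hz : z ∉ affineSpan ℝ (insert y T)) : Disjoint (segment ℝ y z) T := by
  rw [Set.disjoint_left]
  intro m hm hmT
  rw [segment_eq_image_lineMap] at hm
  obtain ⟨t, -, rfl⟩ := hm
  have ht : t ≠ 0 := by
    rintro rfl
    exact hy (by simpa using hmT)
  have h1 : y ∈ affineSpan ℝ (insert y T) := subset_affineSpan ℝ _ (mem_insert _ _)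
  have h2 := subset_affineSpan ℝ (insert y T) (mem_insert_of_mem y hmT)
  apply hz
  have h3 := AffineMap.lineMap_mem t⁻¹ h1 h2
  convert h3 using 1
  simp [AffineMap.lineMap_apply, smul_smul, ht]

theorem IsThin.isPreconnected_compl_sUnion [FiniteDimensional ℝ V] {𝒯 : Set (Set V)}
    (hfin : 𝒯.Finite) (h𝒯 : ∀ T ∈ 𝒯, IsThin T) : IsPreconnected (⋃₀ 𝒯)ᶜ := by
  refine isPreconnected_of_forall_pair fun a ha b hb => ?_
  obtain ⟨z, hz⟩ := (dense_biInter_compl_affineSubspace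
    ((hfin.image fun T => affineSpan ℝ (insert a T)).union
      (hfin.image fun T => affineSpan ℝ (insert b T))) (by
      rintro _ (⟨T, hT, rfl⟩ | ⟨T, hT, rfl⟩)
      exacts [h𝒯 T hT a, h𝒯 T hT b])).nonempty
  refine ⟨segment ℝ a z ∪ segment ℝ b z, ?_, Or.inl (left_mem_segment _ _ _),
    Or.inr (left_mem_segment _ _ _), IsPreconnected.union z (right_mem_segment _ _ _)
    (right_mem_segment _ _ _) (convex_segment _ _).isPreconnected
    (convex_segment _ _).isPreconnected⟩
  rintro m (hm | hm) ⟨T, hT, hmT⟩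
  · exact Set.disjoint_left.1 (disjoint_segment_of_notMem_affineSpan (fun h => ha ⟨T, hT, h⟩)
      (hz _ (Or.inl ⟨T, hT, rfl⟩))) hm hmT
  · exact Set.disjoint_left.1 (disjoint_segment_of_notMem_affineSpan (fun h => hb ⟨T, hT, h⟩)
      (hz _ (Or.inr ⟨T, hT, rfl⟩))) hm hmT

theorem IsThin.image [FiniteDimensional ℝ V] {T : Set V} (hT : IsThin T) {f : V →ᵃ[ℝ] V}
    (hf : Function.Bijective f) : IsThin (f '' T) := by
  intro y hy
  obtain ⟨x, rfl⟩ := hf.2 y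
  rw [← image_insert_eq, ← AffineSubspace.map_span] at hy
  refine hT x (eq_top_iff.2 fun z _ => ?_)
  have hz : f z ∈ (affineSpan ℝ (insert x T)).map f := hy ▸ AffineSubspace.mem_top ℝ V _
  obtain ⟨w, hw, hwz⟩ := hz
  exact hf.1 hwz ▸ hw

/-- If a set is not thin, then a linear functional suffices to describe the directions which
are not parallel to it. -/
theorem exists_functional_of_not_isThin {T : Set V} (hT : ¬ IsThin T) {x : V}
    {D : Submodule ℝ V} (hD : ∀ t ∈ T, t - x ∈ D) :
    ∃ (ℓ : V →ₗ[ℝ] ℝ) (w : V), ∀ h, h - ℓ h • w ∈ D := by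
  simp only [IsThin, not_forall, not_not] at hT
  obtain ⟨y, hy⟩ := hT
  have hsup : D ⊔ Submodule.span ℝ {y - x} = ⊤ := by
    have hle : affineSpan ℝ (insert y T) ≤
        AffineSubspace.mk' x (D ⊔ Submodule.span ℝ {y - x}) := by
      rw [affineSpan_le]
      rintro t (rfl | ht)
      · exact Submodule.mem_sup_right (Submodule.mem_span_singleton_self _)
      · exact Submodule.mem_sup_left (hD t ht)
    rw [hy, top_le_iff] at hle
    have := congrArg AffineSubspace.direction hle
    simpa using this
  by_cases hw : y - x ∈ D
  · refine ⟨0, 0, fun h => ?_⟩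
    have : D = ⊤ := by
      rw [← hsup, eq_comm, sup_eq_left]
      simpa using hw
    simp [this]
  · obtain ⟨ℓ, hℓ, hDℓ⟩ := Submodule.exists_le_ker_of_notMem hw
    refine ⟨ℓ, (ℓ (y - x))⁻¹ • (y - x), fun h => ?_⟩
    have hh : h ∈ D ⊔ Submodule.span ℝ {y - x} := hsup ▸ Submodule.mem_top
    obtain ⟨d, hd, _, hs, rfl⟩ := Submodule.mem_sup.1 hh
    obtain ⟨c, rfl⟩ := Submodule.mem_span_singleton.1 hs
    have hd0 : ℓ d = 0 := hDℓ hd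
    convert hd using 1
    rw [map_add, hd0, zero_add, map_smul, smul_smul, smul_eq_mul, mul_assoc, mul_inv_cancel₀ hℓ,
      mul_one, add_sub_cancel_right]

theorem IsPreconnected.exists_eqOn_of_selection {F : V → V} {P : Set (V →ᵃ[ℝ] V)}
    (hP : P.Finite) (hclosed : ∀ f ∈ P, IsClosed {y | F y = f y}) (hne : P.Nonempty)
    {K : Set V} (hK : IsPreconnected K) (hsel : ∀ y ∈ K, ∃ f ∈ P, F y = f y)
    (huniq : ∀ y ∈ K, ∀ f ∈ P, ∀ g ∈ P, f y = g y → f = g) :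
    ∃ f ∈ P, ∀ y ∈ K, F y = f y := by
  rcases K.eq_empty_or_nonempty with rfl | ⟨y₀, hy₀⟩
  · exact ⟨hne.some, hne.some_mem, by simp⟩
  obtain ⟨f, hf, hfy⟩ := hsel y₀ hy₀
  refine ⟨f, hf, fun y hy => ?_⟩
  by_contra hne
  have hcl : IsClosed (⋃ g ∈ P \ {f}, {y | F y = g y}) :=
    (hP.subset sdiff_subset).isClosed_biUnion fun g hg => hclosed g hg.1
  have hcover : ∀ z ∈ K, F z ≠ f z → z ∈ ⋃ g ∈ P \ {f}, {y | F y = g y} := by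
    intro z hz hzf
    obtain ⟨g, hg, hgz⟩ := hsel z hz
    refine mem_biUnion (x := g) ⟨hg, ?_⟩ hgz
    rintro rfl
    exact hzf hgz
  obtain ⟨z, hzK, hzf, hzg⟩ := isPreconnected_closed_iff.1 hK _ _ (hclosed f hf) hcl
    (fun z hz => (em (F z = f z)).imp id (hcover z hz)) ⟨y₀, hy₀, hfy⟩
    ⟨y, hy, hcover y hy hne⟩
  simp only [mem_iUnion] at hzg
  obtain ⟨g, ⟨hg, hgf⟩, hgz⟩ := hzg
  exact hgf (huniq z hzK g hg f hf (hgz.symm.trans hzf))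

/-- The germ at `x` of a piecewise affine map, if `x` does not belong to a thin set on which all
selection functions active at `x` agree: a pair of affine maps glued along a hyperplane. -/
theorem exists_two_pieces [FiniteDimensional ℝ V] {F : V → V} {S : Set (V →ᵃ[ℝ] V)}
    (hS : S.Finite) (hcont : Continuous F) (hsel : ∀ x, ∃ f ∈ S, F x = f x) (x : V)
    (hx : ¬ IsThin (agreeSet {f ∈ S | F x = f x})) :
    ∃ f ∈ S, ∃ g ∈ S, ∃ (ℓ : V →ₗ[ℝ] ℝ) (u : V), F x = f x ∧ F x = g x ∧
      (∀ h, g.linear h = f.linear h + ℓ h • u) ∧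
      ∀ᶠ y in 𝓝 x, (0 ≤ ℓ (y - x) → F y = f y) ∧ (ℓ (y - x) ≤ 0 → F y = g y) := by
  set P : Set (V →ᵃ[ℝ] V) := {f ∈ S | F x = f x} with hPdef
  have hPfin : P.Finite := hS.subset (sep_subset _ _)
  have hPne : P.Nonempty := by
    obtain ⟨f, hf, hfx⟩ := hsel x
    exact ⟨f, hf, hfx⟩
  have hclosed : ∀ f : V →ᵃ[ℝ] V, IsClosed {y | F y = f y} := fun f =>
    isClosed_eq hcont f.continuous_of_finiteDimensional
  let D : Submodule ℝ V := ⨅ f ∈ P, ⨅ g ∈ P, LinearMap.ker (f.linear - g.linear)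
  have hmemD : ∀ h, h ∈ D ↔ ∀ f ∈ P, ∀ g ∈ P, f.linear h = g.linear h := by
    intro h
    simp [D, Submodule.mem_iInf, sub_eq_zero]
  have happly : ∀ f ∈ P, ∀ y, f y = F x + f.linear (y - x) := fun f hf y => by
    rw [hf.2]
    exact f.apply_eq_add_linear_sub x y
  obtain ⟨ℓ, w, hℓ⟩ := exists_functional_of_not_isThin hx (x := x) (D := D) fun t ht => by
    rw [hmemD]
    intro f hf g hg
    have := ht f hf g hg
    rw [happly f hf, happly g hg] at this
    exact add_left_cancel this
  have hlin : ∀ f ∈ P, ∀ g ∈ P, ∀ h,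
      g.linear h = f.linear h + ℓ h • (g.linear w - f.linear w) := by
    intro f hf g hg h
    have := (hmemD _).1 (hℓ h) f hf g hg
    simp only [map_sub, map_smul] at this
    calc g.linear h = (g.linear h - ℓ h • g.linear w) + ℓ h • g.linear w :=
          (sub_add_cancel _ _).symm
      _ = f.linear h + ℓ h • (g.linear w - f.linear w) := by
          rw [← this, smul_sub]
          abel
  have huniq : ∀ y, ℓ (y - x) ≠ 0 → ∀ f ∈ P, ∀ g ∈ P, f y = g y → f = g := by
    intro y hy f hf g hg hfg
    have hu : g.linear w - f.linear w = 0 := by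
      rw [happly f hf, happly g hg, hlin f hf g hg, add_right_inj, left_eq_add,
        smul_eq_zero] at hfg
      exact hfg.resolve_left hy
    ext z
    rw [happly f hf, happly g hg, hlin f hf g hg, hu, smul_zero, add_zero]
  have hnear : ∀ᶠ y in 𝓝 x, ∃ f ∈ P, F y = f y := by
    have : ∀ᶠ y in 𝓝 x, ∀ f ∈ S, F x ≠ f x → F y ≠ f y := by
      rw [hS.eventually_all]
      intro f _
      by_cases hfx : F x = f x
      · simp [hfx]
      · filter_upwards [(hclosed f).isOpen_compl.mem_nhds hfx] with y hy _ using hy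
    filter_upwards [this] with y hy
    obtain ⟨f, hf, hfy⟩ := hsel y
    exact ⟨f, ⟨hf, not_not.1 fun h => hy f hf h hfy⟩, hfy⟩
  obtain ⟨r, hr, hball⟩ := Metric.eventually_nhds_iff_ball.1 hnear
  obtain ⟨f, hf, hfK⟩ := IsPreconnected.exists_eqOn_of_selection (F := F) hPfin
    (fun f _ => hclosed f) hPne (K := Metric.ball x r ∩ {y | ℓ x < ℓ y})
    ((convex_ball x r).inter (convex_halfSpace_gt ℓ.isLinear _)).isPreconnected
    (fun y hy => hball y hy.1) fun y hy => huniq y (by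
      rw [map_sub]; exact (sub_pos.2 hy.2).ne')
  obtain ⟨g, hg, hgK⟩ := IsPreconnected.exists_eqOn_of_selection (F := F) hPfin
    (fun f _ => hclosed f) hPne (K := Metric.ball x r ∩ {y | ℓ y < ℓ x})
    ((convex_ball x r).inter (convex_halfSpace_lt ℓ.isLinear _)).isPreconnected
    (fun y hy => hball y hy.1) fun y hy => huniq y (by
      rw [map_sub]; exact (sub_neg.2 hy.2).ne)
  refine ⟨f, hf.1, g, hg.1, ℓ, _, hf.2, hg.2, hlin f hf g hg, ?_⟩
  have hzero : ∀ y ∈ Metric.ball x r, ℓ (y - x) = 0 → ∀ k ∈ P, F y = k y := by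
    intro y hy h0 k hk
    obtain ⟨k', hk', hky⟩ := hball y hy
    rw [hky, happly k' hk', happly k hk, hlin k hk k' hk', h0, zero_smul, add_zero]
  filter_upwards [Metric.ball_mem_nhds x hr] with y hy
  constructor
  · intro h
    rcases h.eq_or_lt with h | h
    · exact hzero y hy h.symm f hf
    · exact hfK y ⟨hy, by rw [map_sub, sub_pos] at h; exact h⟩
  · intro h
    rcases h.eq_or_lt with h | h
    · exact hzero y hy h g hg
    · exact hgK y ⟨hy, by rw [map_sub, sub_neg] at h; exact h⟩

/-- An injective map made of two invertible affine maps glued along a hyperplane is open at the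
points of that hyperplane, and its two pieces have the same orientation. -/
theorem two_pieces_orientation [FiniteDimensional ℝ V] {F : V → V} (hinj : Function.Injective F)
    {f g : V →ᵃ[ℝ] V} (hf : f.linear.det ≠ 0) (hg : g.linear.det ≠ 0) {x : V} (hfx : F x = f x)
    (hgx : F x = g x) {ℓ : V →ₗ[ℝ] ℝ} {u : V} (hfg : ∀ h, g.linear h = f.linear h + ℓ h • u)
    (hF : ∀ᶠ y in 𝓝 x, (0 ≤ ℓ (y - x) → F y = f y) ∧ (ℓ (y - x) ≤ 0 → F y = g y)) :
    0 < f.linear.det * g.linear.det ∧ range F ∈ 𝓝 (F x) := by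
  let A : V ≃ₗ[ℝ] V := LinearMap.equivOfDetNeZero f.linear hf
  let B : V ≃ₗ[ℝ] V := LinearMap.equivOfDetNeZero g.linear hg
  have hA : ∀ h, f.linear h = A h := fun h => rfl
  have hB : ∀ h, g.linear h = B h := fun h => rfl
  set v := A.symm u with hv
  have hBA : ∀ h, A (h + ℓ h • v) = B h := fun h => by
    rw [← hB, hfg, hA, map_add, map_smul, hv, A.apply_symm_apply]
  have hdet : g.linear.det = f.linear.det * (1 + ℓ v) := by
    have : g.linear = f.linear ∘ₗ LinearMap.transvection ℓ v := by
      ext h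
      exact (hBA h).symm
    rw [this, LinearMap.det_comp, LinearMap.transvection.det]
  have hshift : Tendsto (fun h : V => x + h) (𝓝 0) (𝓝 x) := by
    have : Continuous fun h : V => x + h := by fun_prop
    simpa using this.tendsto 0
  have hF' : ∀ᶠ h in 𝓝 (0 : V), (0 ≤ ℓ h → F (x + h) = F x + A h) ∧
      (ℓ h ≤ 0 → F (x + h) = F x + B h) := by
    filter_upwards [hshift.eventually hF] with h hh
    rw [add_sub_cancel_left] at hh
    refine ⟨fun h0 => ?_, fun h0 => ?_⟩
    · rw [hh.1 h0, f.apply_eq_add_linear_sub x, add_sub_cancel_left, hfx, hA]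
    · rw [hh.2 h0, g.apply_eq_add_linear_sub x, add_sub_cancel_left, hgx, hB]
  have hpos : 0 < 1 + ℓ v := by
    by_contra hneg
    have hneg : 1 + ℓ v < 0 := lt_of_le_of_ne (not_lt.1 hneg) fun h0 => hg (by simp [hdet, h0])
    have t1 : Tendsto (fun t : ℝ => t • v) (𝓝[>] 0) (𝓝 0) := by
      have : Continuous fun t : ℝ => t • v := by fun_prop
      simpa using (this.tendsto 0).mono_left nhdsWithin_le_nhds
    have t2 : Tendsto (fun t : ℝ => t • v + ℓ (t • v) • v) (𝓝[>] 0) (𝓝 0) := by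
      have : Continuous fun t : ℝ => t • v + ℓ (t • v) • v := by
        simp only [map_smul, smul_eq_mul]
        fun_prop
      simpa using (this.tendsto 0).mono_left nhdsWithin_le_nhds
    obtain ⟨t, h1, h2, ht⟩ := ((t1.eventually hF').and
      ((t2.eventually hF').and self_mem_nhdsWithin)).exists
    have ht : 0 < t := ht
    have e1 := h1.2 (by rw [map_smul, smul_eq_mul]; nlinarith)
    have e2 := h2.1 (by
      simp only [map_add, map_smul, smul_eq_mul]
      nlinarith [mul_pos ht (mul_pos_of_neg_of_neg hneg (by linarith : ℓ v < 0))])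
    rw [hBA, ← e1] at e2
    have := add_left_cancel (hinj e2)
    rw [add_eq_left, map_smul, smul_eq_mul, smul_eq_zero] at this
    rcases this with h | h
    · rcases mul_eq_zero.1 h with h | h <;> linarith
    · rw [h, map_zero] at hneg
      linarith
  refine ⟨?_, ?_⟩
  · rw [hdet, ← mul_assoc]
    exact mul_pos (mul_self_pos.2 hf) hpos
  have tA : Tendsto (fun z => A.symm (z - F x)) (𝓝 (F x)) (𝓝 0) := by
    have : Continuous fun z => A.symm (z - F x) :=
      (LinearMap.continuous_of_finiteDimensional A.symm.toLinearMap).comp (by fun_prop)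
    simpa using this.tendsto (F x)
  have tB : Tendsto (fun z => B.symm (z - F x)) (𝓝 (F x)) (𝓝 0) := by
    have : Continuous fun z => B.symm (z - F x) :=
      (LinearMap.continuous_of_finiteDimensional B.symm.toLinearMap).comp (by fun_prop)
    simpa using this.tendsto (F x)
  filter_upwards [tA.eventually hF', tB.eventually hF'] with z hzA hzB
  by_cases h0 : 0 ≤ ℓ (A.symm (z - F x))
  · exact ⟨_, by rw [hzA.1 h0, A.apply_symm_apply, add_sub_cancel]⟩
  · set h' := B.symm (z - F x) with hh'
    have : A.symm (z - F x) = h' + ℓ h' • v := by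
      rw [LinearEquiv.symm_apply_eq, hBA, hh', B.apply_symm_apply]
    rw [this, map_add, map_smul, smul_eq_mul] at h0
    exact ⟨_, by rw [hzB.2 (by nlinarith), hh', B.apply_symm_apply, add_sub_cancel]⟩

theorem AffineMap.eq_of_eqOn_open {f g : V →ᵃ[ℝ] V} {U : Set V} (hU : IsOpen U)
    (hne : U.Nonempty) (h : EqOn f g U) : f = g := by
  obtain ⟨x, hx⟩ := hne
  have hlin : ∀ v, f.linear v = g.linear v := by
    intro v
    have hev : ∀ᶠ t : ℝ in 𝓝[≠] 0, x + t • v ∈ U := by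
      have : Continuous fun t : ℝ => x + t • v := by fun_prop
      exact (this.tendsto 0).mono_left nhdsWithin_le_nhds (hU.mem_nhds (by simpa using hx))
    obtain ⟨t, htU, ht⟩ := (hev.and self_mem_nhdsWithin).exists
    have := h htU
    rw [f.apply_eq_add_linear_sub x, g.apply_eq_add_linear_sub x, h hx] at this
    simpa [show t ≠ 0 from ht] using this
  ext y
  rw [f.apply_eq_add_linear_sub x, g.apply_eq_add_linear_sub x, h hx, hlin]

theorem AffineMap.linear_det_ne_zero_of_injOn_open [FiniteDimensional ℝ V] {f : V →ᵃ[ℝ] V}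
    {U : Set V} (hU : IsOpen U) (hne : U.Nonempty) (h : InjOn f U) : f.linear.det ≠ 0 := by
  intro hdet
  obtain ⟨x, hx⟩ := hne
  obtain ⟨v, hv, hv0⟩ := (Submodule.ne_bot_iff _).1 (LinearMap.bot_lt_ker_of_det_eq_zero hdet).ne'
  have hev : ∀ᶠ t : ℝ in 𝓝[≠] 0, x + t • v ∈ U := by
    have : Continuous fun t : ℝ => x + t • v := by fun_prop
    exact (this.tendsto 0).mono_left nhdsWithin_le_nhds (hU.mem_nhds (by simpa using hx))
  obtain ⟨t, htU, ht⟩ := (hev.and self_mem_nhdsWithin).exists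
  have := h htU hx (by
    rw [f.apply_eq_add_linear_sub x]
    simp [LinearMap.mem_ker.1 hv])
  simp [hv0, show t ≠ 0 from ht] at this

theorem exists_nonempty_inter_interior [FiniteDimensional ℝ V] {F : V → V} {S : Set (V →ᵃ[ℝ] V)}
    (hS : S.Finite) (hcont : Continuous F) (hsel : ∀ x, ∃ f ∈ S, F x = f x) {U : Set V}
    (hU : IsOpen U) (hne : U.Nonempty) :
    ∃ f ∈ S, (U ∩ interior {y | F y = f y}).Nonempty := by
  have : ProperSpace V := FiniteDimensional.proper ℝ V
  have hd := dense_biUnion_interior_of_closed (S := S) (f := fun f => {y | F y = f y})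
    (fun f _ => isClosed_eq hcont f.continuous_of_finiteDimensional) hS.countable
    (eq_univ_of_forall fun x => by simpa using hsel x)
  obtain ⟨y, hyU, hy⟩ := hd.inter_open_nonempty U hU hne
  simp only [mem_iUnion] at hy
  obtain ⟨f, hf, hyf⟩ := hy
  exact ⟨f, hf, y, hyU, hyf⟩

/-- The selection functions that coincide with `F` on a nonempty open set suffice to
represent `F`. -/
theorem exists_essential_selection [FiniteDimensional ℝ V] {F : V → V} {S : Set (V →ᵃ[ℝ] V)}
    (hS : S.Finite) (hcont : Continuous F) (hsel : ∀ x, ∃ f ∈ S, F x = f x) (x : V) :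
    ∃ f ∈ {f ∈ S | (interior {y | F y = f y}).Nonempty}, F x = f x := by
  by_contra hx
  set S' := {f ∈ S | (interior {y | F y = f y}).Nonempty}
  have hcl : IsClosed (⋃ f ∈ S', {y | F y = f y}) :=
    (hS.subset (sep_subset _ _)).isClosed_biUnion fun f _ =>
      isClosed_eq hcont f.continuous_of_finiteDimensional
  obtain ⟨f, hf, y, hy, hyf⟩ := exists_nonempty_inter_interior hS hcont hsel hcl.isOpen_compl
    ⟨x, by simpa using hx⟩
  exact hy (mem_biUnion (x := f) ⟨hf, y, hyf⟩ (interior_subset hyf))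

theorem AffineMap.bijective_of_linear_det_ne_zero [FiniteDimensional ℝ V] {f : V →ᵃ[ℝ] V}
    (hf : f.linear.det ≠ 0) : Function.Bijective f :=
  ⟨f.linear_injective_iff.1 (LinearMap.equivOfDetNeZero f.linear hf).injective,
    f.linear_surjective_iff.1 (LinearMap.equivOfDetNeZero f.linear hf).surjective⟩

theorem isClosed_range_of_selection [FiniteDimensional ℝ V] {F : V → V} {S : Set (V →ᵃ[ℝ] V)}
    (hS : S.Finite) (hcont : Continuous F) (hsel : ∀ x, ∃ f ∈ S, F x = f x)
    (hdet : ∀ f ∈ S, f.linear.det ≠ 0) : IsClosed (range F) := by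
  have hrange : range F = ⋃ f ∈ S, f '' {y | F y = f y} := by
    ext z
    simp only [mem_range, mem_iUnion, mem_image, mem_ofPred_eq]
    constructor
    · rintro ⟨x, rfl⟩
      obtain ⟨f, hf, hfx⟩ := hsel x
      exact ⟨f, hf, x, hfx, hfx.symm⟩
    · rintro ⟨f, -, x, hfx, rfl⟩
      exact ⟨x, hfx⟩
  rw [hrange]
  refine hS.isClosed_biUnion fun f hf => ?_
  let e := (AffineEquiv.ofBijective
    (f.bijective_of_linear_det_ne_zero (hdet f hf))).toContinuousAffineEquiv.toHomeomorph
  exact e.isClosedMap _ (isClosed_eq hcont f.continuous_of_finiteDimensional)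

/-- An injective piecewise affine map all of whose selection functions are essential is
surjective, and its selection functions all have the same orientation. -/
theorem surjective_and_exists_sign [FiniteDimensional ℝ V] {F : V → V} {S : Set (V →ᵃ[ℝ] V)}
    (hS : S.Finite) (hcont : Continuous F) (hsel : ∀ x, ∃ f ∈ S, F x = f x)
    (hess : ∀ f ∈ S, (interior {y | F y = f y}).Nonempty) (hinj : Function.Injective F) :
    Function.Surjective F ∧
      ∃ ε : ℝ, (ε = 1 ∨ ε = -1) ∧ ∀ f ∈ S, Real.sign f.linear.det = ε := by
  have hclosed : ∀ f : V →ᵃ[ℝ] V, IsClosed {y | F y = f y} := fun f =>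
    isClosed_eq hcont f.continuous_of_finiteDimensional
  have hdet : ∀ f ∈ S, f.linear.det ≠ 0 := fun f hf =>
    AffineMap.linear_det_ne_zero_of_injOn_open isOpen_interior (hess f hf) fun a ha b hb hab =>
      hinj (by rw [interior_subset ha, interior_subset hb, hab])
  have hbij : ∀ f ∈ S, Function.Bijective f := fun f hf =>
    f.bijective_of_linear_det_ne_zero (hdet f hf)
  let 𝒬 : Set (Set (V →ᵃ[ℝ] V)) := {P | P ⊆ S ∧ IsThin (agreeSet P)}
  have h𝒬 : 𝒬.Finite := hS.finite_subsets.subset fun P hP => hP.1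
  let ℬ : Set (Set V) := agreeSet '' 𝒬
  have hℬfin : ℬ.Finite := h𝒬.image _
  have hℬ : ∀ T ∈ ℬ, IsThin T := by
    rintro _ ⟨P, hP, rfl⟩
    exact hP.2
  let 𝒯 : Set (Set V) := image2 (fun (f : V →ᵃ[ℝ] V) P => f '' agreeSet P) S 𝒬
  have h𝒯fin : 𝒯.Finite := hS.image2 _ h𝒬
  have h𝒯 : ∀ T ∈ 𝒯, IsThin T := by
    rintro _ ⟨f, hf, P, hP, rfl⟩
    exact hP.2.image (hbij f hf)
  have hlocal : ∀ x ∉ ⋃₀ ℬ, range F ∈ 𝓝 (F x) ∧ ∃ f ∈ S, ∃ g ∈ S,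
      0 < f.linear.det * g.linear.det ∧ ∀ᶠ y in 𝓝 x, F y = f y ∨ F y = g y := by
    intro x hx
    obtain ⟨f, hf, g, hg, ℓ, u, hfx, hgx, hfg, hev⟩ := exists_two_pieces hS hcont hsel x
      fun h => hx ⟨_, ⟨_, ⟨sep_subset _ _, h⟩, rfl⟩, fun f hf g hg => hf.2.symm.trans hg.2⟩
    obtain ⟨hpos, hrange⟩ := two_pieces_orientation hinj (hdet f hf) (hdet g hg) hfx hgx hfg hev
    refine ⟨hrange, f, hf, g, hg, hpos, ?_⟩
    filter_upwards [hev] with y hy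
    exact (le_total 0 (ℓ (y - x))).imp hy.1 hy.2
  have hBdense := IsThin.dense_compl_sUnion hℬfin hℬ
  have hTdense := IsThin.dense_compl_sUnion h𝒯fin h𝒯
  have himage : ∀ x, F x ∉ ⋃₀ 𝒯 → range F ∈ 𝓝 (F x) := by
    intro x hx
    refine (hlocal x ?_).1
    rintro ⟨_, ⟨P, hP, rfl⟩, hxP⟩
    obtain ⟨f, hf, hfx⟩ := hsel x
    exact hx ⟨_, ⟨f, hf, P, hP, rfl⟩, x, hxP, hfx.symm⟩
  have hrange := isClosed_range_of_selection hS hcont hsel hdet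
  constructor
  · have hsub : (⋃₀ 𝒯)ᶜ ⊆ interior (range F) := by
      refine (isPreconnected_iff_subset_of_disjoint.1
        (IsThin.isPreconnected_compl_sUnion h𝒯fin h𝒯) _ _ isOpen_interior hrange.isOpen_compl
        ?_ ?_).resolve_right ?_
      · intro z hz
        by_cases hzF : z ∈ range F
        · obtain ⟨x, rfl⟩ := hzF
          exact Or.inl (mem_interior_iff_mem_nhds.2 (himage x hz))
        · exact Or.inr hzF
      · rw [(disjoint_compl_right.mono_left interior_subset).inter_eq, inter_empty]
      · intro hsub
        obtain ⟨x, hx⟩ := hBdense.nonempty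
        obtain ⟨z, hz, hzT⟩ := hTdense.inter_open_nonempty _ isOpen_interior
          ⟨F x, mem_interior_iff_mem_nhds.2 (hlocal x hx).1⟩
        exact hsub hzT (interior_subset hz)
    rw [← range_eq_univ, ← hrange.closure_eq]
    exact (hTdense.mono (hsub.trans interior_subset)).closure_eq
  let O : ℝ → Set V := fun s => ⋃₀ {U | IsOpen U ∧
    ∀ f ∈ S, (U ∩ interior {y | F y = f y}).Nonempty → Real.sign f.linear.det = s}
  have hO : ∀ s, IsOpen (O s) := fun s => isOpen_sUnion fun U hU => hU.1
  have hBO : (⋃₀ ℬ)ᶜ ⊆ O 1 ∪ O (-1) := by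
    intro x hx
    obtain ⟨-, f, hf, g, hg, hpos, hev⟩ := hlocal x hx
    obtain ⟨U, hU, hUo, hxU⟩ := eventually_nhds_iff.1 hev
    have hmem : x ∈ O (Real.sign f.linear.det) := by
      refine ⟨U, ⟨hUo, fun k hk hne => ?_⟩, hxU⟩
      have hkF : ∀ y ∈ interior {y | F y = k y}, F y = k y := fun y hy =>
        interior_subset (s := {y | F y = k y}) hy
      have hWo : IsOpen (U ∩ interior {y | F y = k y}) := hUo.inter isOpen_interior
      by_cases hW : U ∩ interior {y | F y = k y} ⊆ {y | F y = f y}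
      · rw [AffineMap.eq_of_eqOn_open hWo hne fun y hy =>
          (hkF y hy.2).symm.trans (hW hy)]
      · obtain ⟨y, hy, hyf⟩ := not_subset.1 hW
        rw [AffineMap.eq_of_eqOn_open (f := k) (g := g) (hWo.inter (hclosed f).isOpen_compl)
          ⟨y, hy, hyf⟩ fun z hz => (hkF z hz.1.2).symm.trans
            ((hU z hz.1.1).resolve_left hz.2)]
        rcases pos_and_pos_or_neg_and_neg_of_mul_pos hpos with ⟨h1, h2⟩ | ⟨h1, h2⟩
        · rw [Real.sign_of_pos h1, Real.sign_of_pos h2]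
        · rw [Real.sign_of_neg h1, Real.sign_of_neg h2]
    rcases Real.sign_apply_eq_of_ne_zero _ (hdet f hf) with h | h <;> rw [h] at hmem
    exacts [Or.inr hmem, Or.inl hmem]
  have hdisj : (⋃₀ ℬ)ᶜ ∩ (O 1 ∩ O (-1)) = ∅ := by
    rw [eq_empty_iff_forall_notMem]
    rintro x ⟨-, ⟨U₁, ⟨hU₁, h₁⟩, hx₁⟩, ⟨U₂, ⟨hU₂, h₂⟩, hx₂⟩⟩
    obtain ⟨f, hf, y, hy, hyf⟩ := exists_nonempty_inter_interior hS hcont hsel (hU₁.inter hU₂)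
      ⟨x, hx₁, hx₂⟩
    have := (h₁ f hf ⟨y, hy.1, hyf⟩).symm.trans (h₂ f hf ⟨y, hy.2, hyf⟩)
    norm_num at this
  have hsign : ∀ s, (⋃₀ ℬ)ᶜ ⊆ O s → ∀ f ∈ S, Real.sign f.linear.det = s := by
    intro s hs f hf
    obtain ⟨y, hyf, hyB⟩ := hBdense.inter_open_nonempty _ isOpen_interior (hess f hf)
    obtain ⟨U, hU, hyU⟩ := hs hyB
    exact hU.2 f hf ⟨y, hyU, hyf⟩
  rcases isPreconnected_iff_subset_of_disjoint.1 (IsThin.isPreconnected_compl_sUnion hℬfin hℬ)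
    _ _ (hO 1) (hO (-1)) hBO hdisj with h | h
  exacts [⟨1, Or.inl rfl, hsign 1 h⟩, ⟨-1, Or.inr rfl, hsign (-1) h⟩]

/-- The derivative of a piecewise affine map is the linear part of a selection function. -/
theorem exists_linear_eq_fderiv {F : V → V} {S : Set (V →ᵃ[ℝ] V)} (hS : S.Finite)
    (hsel : ∀ x, ∃ f ∈ S, F x = f x) {x : V} (hx : DifferentiableAt ℝ F x) :
    ∃ f ∈ S, f.linear = (fderiv ℝ F x : V →ₗ[ℝ] V) := by
  have hcover : ⋃ f : S, (LinearMap.ker (f.1.linear - (fderiv ℝ F x : V →ₗ[ℝ] V)) : Set V)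
      = univ := by
    refine eq_univ_of_forall fun h => ?_
    have hfreq : ∃ f ∈ S, ∃ᶠ t : ℝ in 𝓝[≠] 0, F (x + t • h) = f (x + t • h) := by
      by_contra! hne
      obtain ⟨t, ht⟩ := ((hS.eventually_all).2 hne).exists
      obtain ⟨f, hf, hft⟩ := hsel (x + t • h)
      exact ht f hf hft
    obtain ⟨f, hf, hfreq⟩ := hfreq
    have hline : ∀ t : ℝ, f (x + t • h) = f x + t • f.linear h := fun t => by
      rw [f.apply_eq_add_linear_sub x, add_sub_cancel_left, map_smul]
    have hderiv : HasDerivAt (fun t : ℝ => F (x + t • h)) (fderiv ℝ F x h) 0 :=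
      hx.hasFDerivAt.hasLineDerivAt h
    have hfderiv : HasDerivAt (fun t : ℝ => f (x + t • h)) (f.linear h) 0 := by
      rw [funext hline]
      simpa using ((hasDerivAt_id (0 : ℝ)).smul_const (f.linear h)).const_add (f x)
    have hfx : F x = f x := by
      have := tendsto_nhds_unique_of_frequently_eq
        (hderiv.continuousAt.tendsto.mono_left nhdsWithin_le_nhds)
        (hfderiv.continuousAt.tendsto.mono_left nhdsWithin_le_nhds) hfreq
      simpa using this
    have hlin : fderiv ℝ F x h = f.linear h := by
      refine tendsto_nhds_unique_of_frequently_eq (hasDerivAt_iff_tendsto_slope.1 hderiv)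
        (hasDerivAt_iff_tendsto_slope.1 hfderiv) (hfreq.mono fun t ht => ?_)
      simp [slope, ht, hfx]
    exact mem_iUnion.2 ⟨⟨f, hf⟩, by simp [hlin]⟩
  have := hS.to_subtype
  obtain ⟨f, hf⟩ := Subspace.exists_eq_top_of_iUnion_eq_univ hcover
  exact ⟨f, f.2, sub_eq_zero.1 (LinearMap.ker_eq_top.1 hf)⟩

end PiecewiseAffine

/-- For an injective piecewise affine `F : ℝⁿ → ℝⁿ` there is a sign
`ε ∈ {+1, -1}` such that every regular value `y` of `F` has exactly one preimage `x`, and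
`sign (det D_x F) = ε`. In particular every regular value lies in the image of `F`. -/
theorem injective_pwa_degree_pm_one
    {n : ℕ} (F : (Fin n → ℝ) → (Fin n → ℝ))
    (S : Finset (Matrix (Fin n) (Fin n) ℝ × (Fin n → ℝ)))
    (hF : IsPWA F S) (hinj : Function.Injective F) :
    ∃ ε : ℝ, (ε = 1 ∨ ε = -1) ∧ ∀ y : Fin n → ℝ, IsRegularValue F y →
      ∃ x : Fin n → ℝ, F x = y ∧ (∀ x' : Fin n → ℝ, F x' = y → x' = x) ∧
        Real.sign ((fderiv ℝ F x).det) = ε := by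
  obtain ⟨hcont, hsel⟩ := hF
  let toAffine : Matrix (Fin n) (Fin n) ℝ × (Fin n → ℝ) → (Fin n → ℝ) →ᵃ[ℝ] (Fin n → ℝ) :=
    fun p => (Matrix.toLin' p.1).toAffineMap + AffineMap.const ℝ _ p.2
  have hS : (toAffine '' S).Finite := S.finite_toSet.image _
  have hsel' : ∀ x, ∃ f ∈ toAffine '' S, F x = f x := fun x => by
    obtain ⟨p, hp, hpx⟩ := hsel x
    exact ⟨_, ⟨p, hp, rfl⟩, by simpa [toAffine, affMap] using hpx⟩
  have hess := exists_essential_selection hS hcont hsel'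
  have hS' := hS.subset (sep_subset _ fun f => (interior {y | F y = f y}).Nonempty)
  obtain ⟨hsurj, ε, hε, hsign⟩ :=
    surjective_and_exists_sign hS' hcont hess (fun f hf => hf.2) hinj
  refine ⟨ε, hε, fun y hy => ?_⟩
  obtain ⟨x, rfl⟩ := hsurj y
  refine ⟨x, rfl, fun x' hx' => hinj hx', ?_⟩
  obtain ⟨f, hf, hfx⟩ := exists_linear_eq_fderiv hS' hess (hy x rfl).1
  rw [← hsign f hf, hfx]
end
end
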